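/- arXiv:1402.4688 — 2 statements merged into one kernel-verified Lean document; each statement's English description precedes it below -/
import Mathlib

section
/- Let σ > -1 and λ = d+1+σ. For every norm |·| on ℂ^{d̃} satisfying |conj(Z)| = |Z|, there exist sequences z_m ∈ B and measurable functions G_m on B with ‖G_m‖_∞ ≤ 1 such that liminf_{m→∞} (1-|z_m|²)^n |D_z(T_σ G_m)(z_m)| ≥ 𝓒 · Γ(λ+n)Γ(n) / Γ((λ+n)/2)², where 𝓒 = max_{|ζ|=1} |Z(ζ)|; consequently ‖T_σ‖_{L^∞(B) → 𝓑} ≥ 𝓒 · Γ(λ+n)Γ(n) / Γ((λ+n)/2)². -/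
open MeasureTheory Complex Metric
open scoped ENNReal Classical

noncomputable section

abbrev Cd (d : ℕ) : Type := EuclideanSpace ℂ (Fin d)

instance (d : ℕ) : MeasurableSpace (Cd d) := borel _
instance (d : ℕ) : BorelSpace (Cd d) := ⟨rfl⟩
noncomputable instance (d : ℕ) : MeasureSpace (Cd d) := measureSpaceOfInnerProductSpace

/-- The open unit ball of `ℂ^d`. -/
def unitBall (d : ℕ) : Set (Cd d) := Metric.ball 0 1

/-- Lebesgue measure on `ℂ^d`, normalized so that the unit ball has measure one. -/
def normVol (d : ℕ) : Measure (Cd d) := (volume (unitBall d))⁻¹ • volume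

/-- The inner product `⟨z,w⟩ = ∑ z_j conj (w_j)`. -/
def herm {d : ℕ} (z w : Cd d) : ℂ := ∑ j, z j * (starRingEnd ℂ) (w j)

/-- The normalizing constant `c_σ`. -/
def cCoef (d : ℕ) (σ : ℝ) : ℝ :=
  Real.Gamma (d + σ + 1) / (Real.Gamma (σ + 1) * Real.Gamma (d + 1))

/-- The Bergman kernel `K_σ(z,w) = (1-|w|²)^σ / (1-⟨z,w⟩)^{d+1+σ}`. -/
def bergKer (d : ℕ) (σ : ℝ) (z w : Cd d) : ℂ :=
  (((1 - ‖w‖ ^ 2 : ℝ) ^ σ : ℝ) : ℂ) / (1 - herm z w) ^ ((((d : ℝ) + 1 + σ : ℝ)) : ℂ)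

/-- The Bergman projection `T_σ f (z) = c_σ ∫_B K_σ(z,w) f(w) dv(w)`. -/
def bergman (d : ℕ) (σ : ℝ) (f : Cd d → ℂ) (z : Cd d) : ℂ :=
  (cCoef d σ : ℂ) * ∫ w in unitBall d, bergKer d σ z w * f w ∂(normVol d)

/-- The complex partial derivative `∂/∂z_j`. -/
def pd (d : ℕ) (j : Fin d) (f : Cd d → ℂ) : Cd d → ℂ :=
  fun z => fderiv ℂ f z (EuclideanSpace.single j 1)

/-- The complex partial derivative `∂^α` for a multi-index `α`. -/
def mpd (d : ℕ) (α : Fin d → ℕ) (f : Cd d → ℂ) : Cd d → ℂ :=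
  (List.finRange d).foldr (fun j g => (pd d j)^[α j] g) f

/-- Multi-indices `α ∈ ℤ₊^d` with `|α| = n`; there are `d̃ = (n+d-1).choose (d-1)` of them. -/
def MIdx (d n : ℕ) : Type := {α : Fin d → ℕ // ∑ j, α j = n}

instance (d n : ℕ) : Fintype (MIdx d n) :=
  Fintype.subtype (Finset.Nat.antidiagonalTuple d n)
    (fun _ => Finset.Nat.mem_antidiagonalTuple)

/-- `𝒟_z f (z) = (∂^α f(z))_{|α|=n} ∈ ℂ^{d̃}`. -/
def Dmap (d n : ℕ) (f : Cd d → ℂ) (z : Cd d) : MIdx d n → ℂ := fun α => mpd d α.1 f z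

/-- `Z(ζ) = (ζ^α)_{|α|=n} ∈ ℂ^{d̃}`. -/
def Zmap (d n : ℕ) (ζ : Cd d) : MIdx d n → ℂ := fun α => ∏ j, ζ j ^ α.1 j

/-- The Bloch seminorm `‖f‖_𝓑 = sup_{z∈B} (1-|z|²)^n |𝒟_z f(z)|` w.r.t. a norm `N` on `ℂ^{d̃}`. -/
def blochSemi (d n : ℕ) (N : (MIdx d n → ℂ) → ℝ) (f : Cd d → ℂ) : ℝ :=
  ⨆ z : unitBall d, (1 - ‖(z : Cd d)‖ ^ 2) ^ n * N (Dmap d n f z)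

/-- The seminorm of `T_σ : L^∞(B) → 𝓑`, i.e. `sup_{‖G‖_∞ ≤ 1} ‖T_σ G‖_𝓑`. -/
def opSemi (d n : ℕ) (σ : ℝ) (N : (MIdx d n → ℂ) → ℝ) : ℝ :=
  ⨆ G : {G : Cd d → ℂ // Measurable G ∧ ∀ w, ‖G w‖ ≤ 1},
    blochSemi d n N (bergman d σ G.1)

/-- `𝓒 = max_{|ζ|=1} |Z(ζ)|`. -/
def maxC (d n : ℕ) (N : (MIdx d n → ℂ) → ℝ) : ℝ :=
  ⨆ ζ : Metric.sphere (0 : Cd d) 1, N (Zmap d n (ζ : Cd d))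

/-- The Möbius automorphism `φ_z` of the unit ball, with `φ_0 = -id`. -/
def moebius (d : ℕ) (z ω : Cd d) : Cd d :=
  if z = 0 then -ω
  else (1 - herm ω z)⁻¹ •
    (z - (herm ω z / ((‖z‖ ^ 2 : ℝ) : ℂ)) • z
       - ((Real.sqrt (1 - ‖z‖ ^ 2) : ℝ) : ℂ) • (ω - (herm ω z / ((‖z‖ ^ 2 : ℝ) : ℂ)) • z))

end

namespace BPS
open Filter Topology

lemma gq (s : ℝ) (hs : 0 < s) :
    Tendsto (fun k : ℕ => (k:ℝ) ^ s * Real.Gamma (k + 1) / Real.Gamma (k + 1 + s)) atTop (𝓝 1) := by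
  have h := (Real.GammaSeq_tendsto_Gamma s).div_const (Real.Gamma s)
  rw [div_self (Real.Gamma_pos_of_pos hs).ne'] at h
  refine h.congr fun k => ?_
  have hp : ∀ m : ℕ, (∏ j ∈ Finset.range m, (s + j)) * Real.Gamma s = Real.Gamma (s + m) := by
    intro m
    induction m with
    | zero => simp
    | succ m ih =>
      rw [Finset.prod_range_succ, mul_right_comm, ih]
      push_cast
      rw [← add_assoc, Real.Gamma_add_one (by positivity)]
      ring
  have := hp (k + 1)
  rw [Real.GammaSeq, div_div, this, Real.Gamma_nat_eq_factorial]
  push_cast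
  ring_nf

lemma ratio_tendsto (n : ℕ) (hn : 0 < n) (l : ℝ) (hl : 0 < l) :
    Tendsto (fun k : ℕ => (Real.Gamma ((l + n) / 2 + k)) ^ 2 / (Real.Gamma (k + 1) * Real.Gamma (k + l))
      / ((n - 1 + k).choose (n - 1) : ℝ)) atTop (𝓝 (Real.Gamma n)) := by
  have hn' : (0:ℝ) < n := by exact_mod_cast hn
  have ha : 0 < (l + n) / 2 := by positivity
  rw [← tendsto_add_atTop_iff_nat 1]
  have h := (((gq n hn').mul (gq l hl)).div ((gq _ ha).pow 2) (by norm_num)).mul_const (Real.Gamma n)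
  simp only [one_pow, mul_one, div_one, one_mul] at h
  refine h.congr' ?_
  filter_upwards [eventually_gt_atTop 0] with k hk
  have hk' : (0:ℝ) < k := by exact_mod_cast hk
  have e1 : ((k:ℝ) ^ ((l + n) / 2)) ^ 2 = k ^ l * (k:ℝ) ^ (n:ℝ) := by
    rw [← Real.rpow_natCast, ← Real.rpow_mul hk'.le, ← Real.rpow_add hk']
    congr 1; push_cast; ring
  have e2 : ((n - 1 + (k+1)).choose (n - 1) : ℝ) * (Real.Gamma n * Real.Gamma (k + 1 + 1)) = Real.Gamma (k + 1 + n) := by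
    obtain ⟨m, rfl⟩ : ∃ m, n = m + 1 := ⟨n - 1, by omega⟩
    have h1 := Nat.add_choose_mul_factorial_mul_factorial m (k+1)
    have h2 : (k + 1 + ((m + 1 : ℕ):ℝ)) = ((m + (k+1) : ℕ) : ℝ) + 1 := by push_cast; ring
    have h3 : ((k:ℝ) + 1 + 1) = ((k+1 : ℕ) : ℝ) + 1 := by push_cast; ring
    rw [h2, h3, Real.Gamma_nat_eq_factorial, Real.Gamma_nat_eq_factorial]
    push_cast
    rw [Real.Gamma_nat_eq_factorial]
    rw [← Nat.choose_symm_add] at h1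
    rw [← h1]; push_cast [Nat.add_sub_cancel]; ring
  have g1 := Real.Gamma_pos_of_pos (s := k + 1) (by positivity)
  have g2 := Real.Gamma_pos_of_pos (s := k + 1 + 1) (by positivity)
  have g3 := Real.Gamma_pos_of_pos (s := k + 1 + n) (by positivity)
  have g4 := Real.Gamma_pos_of_pos (s := k + 1 + l) (by positivity)
  have g5 := Real.Gamma_pos_of_pos (s := k + 1 + (l + n)/2) (by positivity)
  have g6 := Real.Gamma_pos_of_pos hn'
  have hc : (0:ℝ) < ((n - 1 + (k+1)).choose (n - 1) : ℝ) := by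
    exact_mod_cast Nat.choose_pos (by omega)
  have hA := Real.rpow_pos_of_pos hk' l
  have hB := Real.rpow_pos_of_pos hk' (n:ℝ)
  simp only [Pi.div_apply]
  rw [div_pow, mul_pow, e1]
  push_cast
  rw [add_comm ((l+n)/2) ((k:ℝ)+1), ← e2]
  field_simp

lemma hasSum_geom (n : ℕ) (hn : 0 < n) (x : ℝ) (hx : 0 ≤ x) (hx1 : x < 1) :
    HasSum (fun k : ℕ => ((n - 1 + k).choose (n - 1) : ℝ) * x ^ k) (((1 - x) ^ n)⁻¹) := by
  obtain ⟨m, rfl⟩ : ∃ m, n = m + 1 := ⟨n - 1, by omega⟩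
  have h := hasSum_choose_mul_geometric_of_norm_lt_one' m (r := x) (by rw [Real.norm_of_nonneg hx]; exact hx1)
  simpa [add_comm] using h

lemma abel (n : ℕ) (hn : 0 < n) (A : ℕ → ℝ) (hA : ∀ k, 0 ≤ A k) (L : ℝ)
    (h : Tendsto (fun k : ℕ => A k / ((n - 1 + k).choose (n - 1) : ℝ)) atTop (𝓝 L)) :
    (∃ M, ∀ x, 0 ≤ x → x < 1 → Summable (fun k => A k * x ^ k) ∧ (1 - x) ^ n * ∑' k, A k * x ^ k ≤ M) ∧
    Tendsto (fun x : ℝ => (1 - x) ^ n * ∑' k, A k * x ^ k) (𝓝[Set.Ico 0 1] 1) (𝓝 L) := by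
  set b : ℕ → ℝ := fun k => ((n - 1 + k).choose (n - 1) : ℝ) with hb
  have hbp : ∀ k, 0 < b k := fun k => by
    simp only [hb]; exact_mod_cast Nat.choose_pos (by omega)
  have hbd : ∃ M, ∀ k, A k ≤ M * b k := by
    obtain ⟨M, hM⟩ := h.bddAbove_range
    refine ⟨M, fun k => ?_⟩
    have := hM ⟨k, rfl⟩
    exact (div_le_iff₀ (hbp k)).1 this
  obtain ⟨M, hM⟩ := hbd
  have hs : ∀ x : ℝ, 0 ≤ x → x < 1 → Summable (fun k => A k * x ^ k) := by
    intro x hx hx1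
    refine Summable.of_nonneg_of_le (fun k => by have := hA k; positivity) (fun k => ?_)
      ((hasSum_geom n hn x hx hx1).summable.mul_left M)
    have := hM k
    have hp : 0 ≤ x ^ k := by positivity
    calc A k * x ^ k ≤ (M * b k) * x ^ k := by gcongr
      _ = _ := by rw [mul_assoc]
  refine ⟨⟨M, fun x hx hx1 => ⟨hs x hx hx1, ?_⟩⟩, ?_⟩
  · have h1 : ∑' k, A k * x ^ k ≤ M * ((1 - x) ^ n)⁻¹ := by
      have hg := (hasSum_geom n hn x hx hx1).mul_left M
      refine hasSum_le (fun k => ?_) (hs x hx hx1).hasSum hg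
      have := hM k
      have hp : 0 ≤ x ^ k := by positivity
      calc A k * x ^ k ≤ (M * b k) * x ^ k := by gcongr
        _ = _ := by rw [mul_assoc]
    have hp : 0 < (1 - x) ^ n := pow_pos (by linarith) n
    calc _ ≤ (1 - x) ^ n * (M * ((1 - x) ^ n)⁻¹) := by gcongr
      _ = M := by field_simp
  · rw [Metric.tendsto_nhds]
    intro ε hε
    have h2 : ∀ᶠ k in atTop, |A k / b k - L| < ε / 2 := by
      have := Metric.tendsto_nhds.1 h (ε / 2) (by linarith)
      simpa [Real.dist_eq] using this
    obtain ⟨K, hK⟩ := eventually_atTop.1 h2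
    set c : ℕ → ℝ := fun k => |A k - L * b k|
    set C := ∑ k ∈ Finset.range K, c k with hC
    have key : ∀ x : ℝ, 0 ≤ x → x < 1 →
        |(1 - x) ^ n * ∑' k, A k * x ^ k - L| ≤ ε / 2 + C * (1 - x) ^ n := by
      intro x hx hx1
      have hg := (hasSum_geom n hn x hx hx1)
      have hp : 0 < (1 - x) ^ n := pow_pos (by linarith) n
      have hd := (hs x hx hx1).hasSum.sub (hg.mul_left L)
      have hfin : HasSum (fun k => if k ∈ Finset.range K then c k else 0) C := by
        have := hasSum_sum_of_ne_finset_zero (L := SummationFilter.unconditional ℕ) (s := Finset.range K)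
          (f := fun k => if k ∈ Finset.range K then c k else 0) (by intro k hk; simp only [if_neg hk])
        rwa [Finset.sum_congr rfl (g := c) (fun k hk => if_pos hk)] at this
      have hup := (hg.mul_left (ε / 2)).add hfin
      have hpt : ∀ k, |A k * x ^ k - L * (b k * x ^ k)| ≤ ε / 2 * (b k * x ^ k) +
          (if k ∈ Finset.range K then c k else 0) := by
        intro k
        have hxk : 0 ≤ x ^ k := by positivity
        have hxk1 : x ^ k ≤ 1 := pow_le_one₀ hx hx1.le
        have e : |A k * x ^ k - L * (b k * x ^ k)| = c k * x ^ k := by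
          rw [show A k * x ^ k - L * (b k * x ^ k) = (A k - L * b k) * x ^ k by ring, abs_mul,
            abs_of_nonneg hxk]
        rw [e]
        have hc0 : 0 ≤ c k := abs_nonneg _
        have hb0 := hbp k
        split_ifs with hk
        · have : c k * x ^ k ≤ c k := mul_le_of_le_one_right hc0 hxk1
          have : 0 ≤ ε / 2 * (b k * x ^ k) := by positivity
          linarith
        · have hk' := hK k (by simpa using hk)
          have : c k ≤ ε / 2 * b k := by
            have e3 : A k - L * b k = (A k / b k - L) * b k := by field_simp
            simp only [c]
            rw [e3, abs_mul, abs_of_pos hb0]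
            gcongr
          calc c k * x ^ k ≤ (ε / 2 * b k) * x ^ k := by gcongr
            _ = _ := by ring
      have h1 := hasSum_le (fun k => (abs_le.1 (hpt k)).2) hd hup
      have h3 := hasSum_le (fun k => (abs_le.1 (hpt k)).1) hup.neg hd
      have h4 : |∑' k, A k * x ^ k - L * ((1 - x) ^ n)⁻¹| ≤ ε / 2 * ((1 - x) ^ n)⁻¹ + C :=
        abs_le.2 ⟨h3, h1⟩
      have e5 : (1 - x) ^ n * ∑' k, A k * x ^ k - L =
        (1 - x) ^ n * (∑' k, A k * x ^ k - L * ((1 - x) ^ n)⁻¹) := by field_simp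
      rw [e5, abs_mul, abs_of_pos hp]
      calc _ ≤ (1 - x) ^ n * (ε / 2 * ((1 - x) ^ n)⁻¹ + C) := by gcongr
        _ = _ := by field_simp
    have ht : Tendsto (fun x : ℝ => ε / 2 + C * (1 - x) ^ n) (𝓝[Set.Ico 0 1] 1) (𝓝 (ε / 2)) := by
      have : Continuous (fun x : ℝ => ε / 2 + C * (1 - x) ^ n) := by fun_prop
      have h5 := (this.tendsto 1).mono_left (nhdsWithin_le_nhds (s := Set.Ico (0:ℝ) 1))
      simpa [hn.ne'] using h5
    filter_upwards [ht.eventually_lt_const (show ε / 2 < ε by linarith), self_mem_nhdsWithin] with x h6 h7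
    rw [Real.dist_eq]
    exact (key x h7.1 h7.2).trans_lt h6

end BPS
namespace BPS
open Filter Topology Set

lemma finrank_Cd (d : ℕ) : Module.finrank ℝ (Cd d) = 2 * d := by
  rw [← Module.finrank_mul_finrank ℝ ℂ (Cd d)]
  simp

lemma sphere_formula (d k : ℕ) (P : Cd d → ℝ) (hP : ∀ (r : ℝ) x, 0 < r → P (r • x) = r ^ k * P x)
    (h : ℝ → ℝ) (hd : 0 < d) :
    ∫ w : Cd d, P w * h ‖w‖ = (∫ θ, P θ ∂(volume : Measure (Cd d)).toSphere) *
      ∫ y in Ioi (0:ℝ), y ^ (2 * d - 1) * (y ^ k * h y) := by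
  have : Nontrivial (Cd d) := by
    have : Nonempty (Fin d) := ⟨⟨0, hd⟩⟩
    exact (inferInstance : Nontrivial (EuclideanSpace ℂ (Fin d)))
  calc ∫ w : Cd d, P w * h ‖w‖ = ∫ x : ({(0)}ᶜ : Set (Cd d)), P x.1 * h (‖x.1‖) ∂((volume : Measure (Cd d)).comap Subtype.val) := by
        rw [integral_subtype_comap (measurableSet_singleton _).compl fun x ↦ P x * h (‖x‖),
          restrict_compl_singleton]
    _ = ∫ x, P x.1 * (x.2.1 ^ k * h x.2.1) ∂(volume : Measure (Cd d)).toSphere.prod (.volumeIoiPow (Module.finrank ℝ (Cd d) - 1)) := by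
      have := (volume : Measure (Cd d)).measurePreserving_homeomorphUnitSphereProd.integral_comp
        (Homeomorph.measurableEmbedding _) (fun x => P x.1 * (x.2.1 ^ k * h x.2.1))
      rw [← this]
      refine integral_congr_ae (Eventually.of_forall fun x => ?_)
      have hx : 0 < ‖x.1‖ := norm_pos_iff.2 x.2
      have h1 : P x.1 = ‖x.1‖ ^ k * P (‖x.1‖⁻¹ • x.1) := by
        rw [← hP _ _ hx, smul_smul, mul_inv_cancel₀ hx.ne', one_smul]
      simp only [homeomorphUnitSphereProd_apply_snd_coe, homeomorphUnitSphereProd_apply_fst_coe]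
      rw [h1]; ring
    _ = _ := by
      rw [integral_prod_mul (fun x : sphere (0 : Cd d) 1 => P x) (fun y : Ioi (0:ℝ) => y.1 ^ k * h y.1)]
      congr 1
      simp only [Measure.volumeIoiPow, ENNReal.ofReal]
      rw [integral_withDensity_eq_integral_smul,
        integral_subtype_comap measurableSet_Ioi fun a : ℝ ↦ Real.toNNReal (a ^ (Module.finrank ℝ (Cd d) - 1)) • (a ^ k * h a),
        setIntegral_congr_fun measurableSet_Ioi fun x hx ↦ ?_]
      · rw [NNReal.smul_def, Real.coe_toNNReal _ (pow_nonneg hx.out.le _), finrank_Cd, smul_eq_mul]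
      · exact (measurable_subtype_coe.pow_const _).real_toNNReal

lemma radial_gauss (d k : ℕ) (hd : 0 < d) :
    ∫ y in Ioi (0:ℝ), y ^ (2 * d - 1) * (y ^ (2 * k) * Real.exp (- y ^ 2)) =
      Real.Gamma (k + d) / 2 := by
  have h := _root_.integral_rpow_mul_exp_neg_rpow (p := 2) (q := (2 * d - 1 + 2 * k : ℕ)) (by norm_num)
    (by have : (0:ℝ) ≤ (2 * d - 1 + 2 * k : ℕ) := by positivity
        linarith)
  have e : (((2 * d - 1 + 2 * k : ℕ):ℝ) + 1) / 2 = k + d := by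
    have : 2 * d - 1 + 2 * k + 1 = 2 * d + 2 * k := by omega
    have h2 : (((2 * d - 1 + 2 * k : ℕ):ℝ) + 1) = 2 * d + 2 * k := by exact_mod_cast this
    rw [h2]; ring
  rw [e] at h
  rw [show Real.Gamma (k + d) / 2 = 1 / 2 * Real.Gamma (k + d) by ring, ← h]
  refine setIntegral_congr_fun measurableSet_Ioi fun x hx => ?_
  rw [Real.rpow_natCast, pow_add, mul_assoc]
  congr 3
  simp

lemma beta_real (a b : ℝ) (ha : 0 < a) (hb : 0 < b) :
    ∫ t in Ioo (0:ℝ) 1, t ^ (a - 1) * (1 - t) ^ (b - 1) =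
      Real.Gamma a * Real.Gamma b / Real.Gamma (a + b) := by
  have h := ProbabilityTheory.beta_eq_betaIntegralReal a b ha hb
  rw [ProbabilityTheory.beta] at h
  rw [h, Complex.betaIntegral, intervalIntegral.integral_of_le zero_le_one, ← integral_Ioc_eq_integral_Ioo,
    ← Complex.reCLM_apply, ← Complex.ofReal_re (∫ t in Ioc (0:ℝ) 1, t ^ (a - 1) * (1 - t) ^ (b - 1)),
    ← integral_complex_ofReal, Complex.reCLM_apply]
  congr 1
  refine setIntegral_congr_fun measurableSet_Ioc fun t ht => ?_
  have h0 : 0 ≤ t := ht.1.le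
  have h1 : 0 ≤ 1 - t := by linarith [ht.2]
  push_cast [Complex.ofReal_cpow h0, Complex.ofReal_cpow h1]
  rfl

lemma radial_beta (d k : ℕ) (hd : 0 < d) (σ : ℝ) (hσ : -1 < σ) :
    ∫ y in Ioi (0:ℝ), y ^ (2 * d - 1) * (y ^ (2 * k) * (Iio (1:ℝ)).indicator (fun y => (1 - y ^ 2) ^ σ) y) =
      Real.Gamma (k + d) * Real.Gamma (σ + 1) / Real.Gamma (k + d + σ + 1) / 2 := by
  have hd' : (0:ℝ) < d := by exact_mod_cast hd
  have hb := beta_real (k + d) (σ + 1) (by positivity) (by linarith)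
  rw [← add_assoc] at hb
  rw [← hb]
  have h := integral_comp_rpow_Ioi (fun t : ℝ => (Iio (1:ℝ)).indicator (fun t => t ^ ((k:ℝ) + d - 1) * (1 - t) ^ (σ + 1 - 1)) t) (p := 2) (by norm_num)
  have e1 : ∫ t in Ioi (0:ℝ), (Iio (1:ℝ)).indicator (fun t : ℝ => t ^ ((k:ℝ) + d - 1) * (1 - t) ^ (σ + 1 - 1)) t
     = ∫ t in Ioo (0:ℝ) 1, t ^ ((k:ℝ) + d - 1) * (1 - t) ^ (σ + 1 - 1) := by
    rw [setIntegral_indicator measurableSet_Iio, Ioi_inter_Iio]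
  rw [← e1, ← h, ← integral_div]
  refine setIntegral_congr_fun measurableSet_Ioi fun y hy => ?_
  have hy : 0 < y := hy
  simp only [Real.rpow_two]
  by_cases h1 : y < 1
  · rw [indicator_of_mem (by exact h1), indicator_of_mem (by simpa using (by nlinarith : y ^ 2 < 1))]
    have e2 : (y ^ 2) ^ ((k:ℝ) + d - 1) = y ^ (2 * (k + d - 1)) := by
      have : ((k:ℝ) + d - 1) = ((k + d - 1 : ℕ) : ℝ) := by
        rw [Nat.cast_sub (by omega)]; push_cast; ring
      rw [this, Real.rpow_natCast, ← pow_mul]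
    rw [e2]
    norm_num
    obtain ⟨m, rfl⟩ : ∃ m, d = m + 1 := ⟨d - 1, by omega⟩
    have e3 : 2 * (m + 1) - 1 = 2 * m + 1 := by omega
    have e4 : k + (m + 1) - 1 = k + m := by omega
    rw [e3, e4]
    ring
  · rw [indicator_of_notMem (by simpa using h1), indicator_of_notMem (by rw [mem_Iio]; nlinarith)]
    simp

lemma gauss_coord (d : ℕ) (j : Fin d) : ∃ c : ℝ, c ≠ 0 ∧
   ∀ k : ℕ, ∫ w : Cd d, ‖w j‖ ^ (2 * k) * Real.exp (- ‖w‖ ^ 2) = c * Real.Gamma (k + 1) := by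
  let e : (Fin d → ℂ) ≃L[ℝ] Cd d := (PiLp.continuousLinearEquiv 2 ℝ (fun _ : Fin d => ℂ)).symm
  let ν : Measure (Cd d) := Measure.map e volume
  have : ν.IsAddHaarMeasure := e.isAddHaarMeasure_map volume
  have hν : (volume : Measure (Cd d)) = Measure.addHaarScalarFactor volume ν • ν := Measure.isAddLeftInvariant_eq_smul _ _
  have hc : (Measure.addHaarScalarFactor (volume : Measure (Cd d)) ν : ℝ) ≠ 0 := by
    have := Measure.addHaarScalarFactor_pos_of_isAddHaarMeasure (volume : Measure (Cd d)) ν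
    exact_mod_cast this.ne'
  have h1 : ∀ q : ℕ, ∫ x : ℂ, ‖x‖ ^ (2 * q) * Real.exp (- ‖x‖ ^ 2) = Real.pi * Real.Gamma (q + 1) := by
    intro q
    have := Complex.integral_rpow_mul_exp_neg_rpow (p := 2) (q := (2 * q : ℕ)) (by norm_num)
      (by have : (0:ℝ) ≤ ((2 * q : ℕ):ℝ) := by positivity
          linarith)
    simp only [Real.rpow_natCast] at this
    rw [show Real.pi * Real.Gamma (q + 1) = (2 * Real.pi / 2) * Real.Gamma ((((2*q:ℕ):ℝ) + 2) / 2) by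
      congr 1 <;> [skip; congr 1] <;> push_cast <;> ring, ← this]
    simp
  refine ⟨Measure.addHaarScalarFactor (volume : Measure (Cd d)) ν * Real.pi ^ d, mul_ne_zero hc (by positivity), fun k => ?_⟩
  generalize Measure.addHaarScalarFactor (volume : Measure (Cd d)) ν = c at hν
  rw [hν, integral_smul_nnreal_measure]
  have h2 : ∫ w, ‖w j‖ ^ (2 * k) * Real.exp (- ‖w‖ ^ 2) ∂ν = Real.pi ^ d * Real.Gamma (k + 1) := by
    have hm : MeasurableEmbedding e := e.toHomeomorph.measurableEmbedding
    rw [hm.integral_map]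
    have h3 : ∀ x : Fin d → ℂ, ‖(e x) j‖ ^ (2 * k) * Real.exp (- ‖e x‖ ^ 2) =
        ∏ i, (‖x i‖ ^ (2 * (if i = j then k else 0)) * Real.exp (- ‖x i‖ ^ 2)) := by
      intro x
      rw [Finset.prod_mul_distrib, ← Real.exp_sum, EuclideanSpace.norm_sq_eq, Finset.sum_neg_distrib]
      congr 1
      rw [Finset.prod_eq_single j]
      · simp [e]
      · intro b _ hb; simp [hb]
      · simp
    simp_rw [h3]
    rw [integral_fintype_prod_volume_eq_prod (fun i (x:ℂ) => ‖x‖ ^ (2 * (if i = j then k else 0)) * Real.exp (- ‖x‖ ^ 2))]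
    simp_rw [h1]
    rw [Finset.prod_mul_distrib]
    rw [Finset.prod_eq_single (f := fun i => Real.Gamma (((if i = j then k else 0 : ℕ) : ℝ) + 1)) j]
    · simp
    · intro b _ hb; simp [hb]
    · simp
  rw [h2]
  simp only [NNReal.smul_def, smul_eq_mul]
  ring

end BPS
namespace BPS
open Filter Topology Set

lemma moment_coord (d : ℕ) (j : Fin d) : ∃ c : ℝ, c ≠ 0 ∧
   ∀ (k : ℕ) (σ : ℝ), -1 < σ → ∫ w in unitBall d, ‖w j‖ ^ (2 * k) * (1 - ‖w‖ ^ 2) ^ σ =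
     c * (Real.Gamma (k + 1) * Real.Gamma (σ + 1) / Real.Gamma (k + d + σ + 1)) := by
  have hd : 0 < d := j.pos
  have hd' : (0:ℝ) < d := by exact_mod_cast hd
  obtain ⟨c, hc, h⟩ := gauss_coord d j
  refine ⟨c, hc, fun k σ hσ => ?_⟩
  have hP : ∀ (r : ℝ) (x : Cd d), 0 < r → ‖(r • x) j‖ ^ (2 * k) = r ^ (2 * k) * ‖x j‖ ^ (2 * k) := by
    intro r x hr
    rw [PiLp.smul_apply, norm_smul, mul_pow, Real.norm_of_nonneg hr.le]
  have h1 := sphere_formula d (2 * k) (fun w => ‖w j‖ ^ (2 * k)) hP (fun y => Real.exp (- y ^ 2)) hd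
  have h2 := sphere_formula d (2 * k) (fun w => ‖w j‖ ^ (2 * k)) hP
    ((Iio (1:ℝ)).indicator (fun y => (1 - y ^ 2) ^ σ)) hd
  rw [h k, radial_gauss d k hd] at h1
  rw [radial_beta d k hd σ hσ] at h2
  have h3 : ∫ w in unitBall d, ‖w j‖ ^ (2 * k) * (1 - ‖w‖ ^ 2) ^ σ =
    ∫ w : Cd d, ‖w j‖ ^ (2 * k) * (Iio (1:ℝ)).indicator (fun y => (1 - y ^ 2) ^ σ) ‖w‖ := by
    rw [← integral_indicator (by unfold unitBall; exact measurableSet_ball)]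
    refine integral_congr_ae (Eventually.of_forall fun w => ?_)
    by_cases hw : ‖w‖ < 1
    · simp [indicator, unitBall, hw]
    · simp [indicator, unitBall, hw]
  rw [h3, h2]
  have g := Real.Gamma_pos_of_pos (s := (k:ℝ) + d) (by positivity)
  linear_combination (-2 * (Real.Gamma (σ + 1) / Real.Gamma (k + d + σ + 1)) / 2) * h1

lemma herm_eq_inner {d : ℕ} (z w : Cd d) : herm z w = inner ℂ w z := by
  simp [herm, PiLp.inner_apply]

lemma norm_herm_le {d : ℕ} (z w : Cd d) : ‖herm z w‖ ≤ ‖z‖ * ‖w‖ := by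
  rw [herm_eq_inner, mul_comm]; exact norm_inner_le_norm _ _

lemma exists_unitary {d : ℕ} (j : Fin d) (z : Cd d) :
    ∃ U : Cd d ≃ₗᵢ[ℂ] Cd d, ∀ w, ‖herm z w‖ = ‖z‖ * ‖(U w) j‖ := by
  by_cases hz : z = 0
  · exact ⟨LinearIsometryEquiv.refl ℂ _, fun w => by simp [hz, herm]⟩
  have hz' : (0:ℝ) < ‖z‖ := norm_pos_iff.2 hz
  let v : Fin d → Cd d := fun _ => ((‖z‖⁻¹ : ℝ) : ℂ) • z
  have hv : Orthonormal ℂ (({j} : Set (Fin d)).domRestrict v) := by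
    constructor
    · intro i
      simp [v, norm_smul, hz'.ne']
    · intro a b hab
      exact absurd (Subsingleton.elim a b) hab
  obtain ⟨b, hb⟩ := hv.exists_orthonormalBasis_extension_of_card_eq (by simp)
  refine ⟨b.repr, fun w => ?_⟩
  rw [b.repr_apply_apply, hb j (by simp), herm_eq_inner]
  simp only [v, inner_smul_left, norm_mul, RCLike.norm_conj]
  rw [norm_inner_symm z w]
  simp
  field_simp

lemma moment (d : ℕ) (hd : 0 < d) (σ : ℝ) (hσ : -1 < σ) (k : ℕ) (z : Cd d) :
    ∫ w in unitBall d, ‖herm z w‖ ^ (2 * k) * (1 - ‖w‖ ^ 2) ^ σ ∂(normVol d) =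
      ‖z‖ ^ (2 * k) * (Real.Gamma (k + 1) * Real.Gamma (σ + 1) * Real.Gamma (d + 1) / Real.Gamma (k + d + σ + 1)) := by
  let j : Fin d := ⟨0, hd⟩
  have hd' : (0:ℝ) < d := by exact_mod_cast hd
  have gd := Real.Gamma_pos_of_pos (s := (d:ℝ) + 1) (by positivity)
  obtain ⟨c, hc, h⟩ := moment_coord d j
  have hvol : (volume (unitBall d)).toReal = c / Real.Gamma (d + 1) := by
    have := h 0 0 (by norm_num)
    simp [Measure.real] at this
    rw [this, div_eq_mul_inv]
  obtain ⟨U, hU⟩ := exists_unitary j z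
  have hmp : MeasurePreserving U (volume : Measure (Cd d)) volume := by
    let U' : Cd d ≃ₗᵢ[ℝ] Cd d :=
      { toLinearEquiv := U.toLinearEquiv.restrictScalars ℝ, norm_map' := U.norm_map }
    exact U'.measurePreserving
  have h1 : ∫ w in unitBall d, ‖herm z w‖ ^ (2 * k) * (1 - ‖w‖ ^ 2) ^ σ =
      ‖z‖ ^ (2 * k) * ∫ w in unitBall d, ‖w j‖ ^ (2 * k) * (1 - ‖w‖ ^ 2) ^ σ := by
    have := hmp.setIntegral_preimage_emb U.toHomeomorph.measurableEmbedding
      (fun w => ‖w j‖ ^ (2 * k) * (1 - ‖w‖ ^ 2) ^ σ) (unitBall d)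
    rw [← this, ← integral_const_mul]
    have e : U ⁻¹' unitBall d = unitBall d := by ext w; simp [unitBall]
    rw [e]
    congr 1
    ext w
    rw [hU, mul_pow, U.norm_map, mul_assoc]
  rw [normVol, Measure.restrict_smul, integral_smul_measure, h1, h k σ hσ, ENNReal.toReal_inv, hvol, smul_eq_mul]
  field_simp

end BPS
namespace BPS
open Filter Topology Set

lemma integral_unitary {d : ℕ} {E : Type*} [NormedAddCommGroup E] [NormedSpace ℝ E]
    (U : Cd d ≃ₗᵢ[ℂ] Cd d) (f : Cd d → E) :
    ∫ w in unitBall d, f (U w) ∂(normVol d) = ∫ w in unitBall d, f w ∂(normVol d) := by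
  have hmp : MeasurePreserving U (volume : Measure (Cd d)) volume := by
    let U' : Cd d ≃ₗᵢ[ℝ] Cd d :=
      { toLinearEquiv := U.toLinearEquiv.restrictScalars ℝ, norm_map' := U.norm_map }
    exact U'.measurePreserving
  have := hmp.setIntegral_preimage_emb U.toHomeomorph.measurableEmbedding f (unitBall d)
  have e : U ⁻¹' unitBall d = unitBall d := by ext w; simp [unitBall]
  rw [e] at this
  simp only [normVol, Measure.restrict_smul, integral_smul_measure, this]

lemma measurable_herm {d : ℕ} (z : Cd d) : Continuous (fun w => herm z w) := by
  unfold herm; fun_prop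

lemma measurable_W (d : ℕ) (σ : ℝ) : Measurable (fun w : Cd d => (1 - ‖w‖ ^ 2) ^ σ) := by
  fun_prop

lemma W_nonneg {d : ℕ} (σ : ℝ) {w : Cd d} (hw : w ∈ unitBall d) : 0 ≤ (1 - ‖w‖ ^ 2) ^ σ := by
  have : ‖w‖ < 1 := by simpa [unitBall] using hw
  exact Real.rpow_nonneg (by nlinarith [norm_nonneg w]) _

lemma measurableSet_unitBall (d : ℕ) : MeasurableSet (unitBall d) := measurableSet_ball

lemma int_W (d : ℕ) (hd : 0 < d) (σ : ℝ) (hσ : -1 < σ) :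
    IntegrableOn (fun w : Cd d => (1 - ‖w‖ ^ 2) ^ σ) (unitBall d) (normVol d) := by
  by_contra hcon
  have h := moment d hd σ hσ 0 0
  have h2 := integral_undef hcon
  simp only [mul_zero, pow_zero, one_mul] at h
  rw [h2] at h
  have hd' : (0:ℝ) < d := by exact_mod_cast hd
  have g1 := Real.Gamma_pos_of_pos (s := (d:ℝ) + 1) (by positivity)
  have g2 := Real.Gamma_pos_of_pos (s := σ + 1) (by linarith)
  have g3 := Real.Gamma_pos_of_pos (s := ((0:ℕ):ℝ) + d + σ + 1) (by push_cast; linarith)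
  have g4 := Real.Gamma_pos_of_pos (s := ((0:ℕ):ℝ) + 1) (by norm_num)
  have : 0 < Real.Gamma (((0:ℕ):ℝ) + 1) * Real.Gamma (σ + 1) * Real.Gamma (d + 1) / Real.Gamma (((0:ℕ):ℝ) + d + σ + 1) := by positivity
  linarith

lemma orth (d : ℕ) (σ : ℝ) (z : Cd d) (j k : ℕ) (hjk : j ≠ k) :
    ∫ w in unitBall d, ((((1 - ‖w‖ ^ 2) ^ σ : ℝ) : ℂ) * (herm z w ^ j * (starRingEnd ℂ) (herm z w) ^ k)) ∂(normVol d) = 0 := by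
  have hm : ((j:ℂ) - k) ≠ 0 := by
    rw [sub_ne_zero]; exact_mod_cast hjk
  set ξ : ℂ := Complex.exp ((Real.pi / ((j:ℝ) - k) : ℝ) * Complex.I) with hξ
  have hn : ‖ξ‖ = 1 := Complex.norm_exp_ofReal_mul_I _
  have h0 : ξ ≠ 0 := Complex.exp_ne_zero _
  have hconj : (starRingEnd ℂ) ξ = Complex.exp (-((Real.pi / ((j:ℝ) - k) : ℝ) * Complex.I)) := by
    rw [hξ, ← Complex.exp_conj]; simp
  have hprod : ((starRingEnd ℂ) ξ) ^ j * ξ ^ k = -1 := by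
    rw [hconj, hξ, ← Complex.exp_nat_mul, ← Complex.exp_nat_mul, ← Complex.exp_add]
    have : (j:ℂ) * -(((Real.pi / ((j:ℝ) - k) : ℝ):ℂ) * Complex.I) + k * (((Real.pi / ((j:ℝ) - k) : ℝ):ℂ) * Complex.I) = -(Real.pi * Complex.I) := by
      push_cast
      field_simp
      ring
    rw [this, Complex.exp_neg, Complex.exp_pi_mul_I]; norm_num
  let U : Cd d ≃ₗᵢ[ℂ] Cd d :=
    { toLinearEquiv := LinearEquiv.smulOfNeZero ℂ (Cd d) ξ h0
      norm_map' := fun w => by simp [norm_smul, hn] }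
  have hU : ∀ w, U w = ξ • w := fun w => rfl
  have h := integral_unitary U (fun w : Cd d => ((((1 - ‖w‖ ^ 2) ^ σ : ℝ) : ℂ) * (herm z w ^ j * (starRingEnd ℂ) (herm z w) ^ k)))
  have e : ∀ w : Cd d, ((((1 - ‖U w‖ ^ 2) ^ σ : ℝ) : ℂ) * (herm z (U w) ^ j * (starRingEnd ℂ) (herm z (U w)) ^ k))
     = (-1) * ((((1 - ‖w‖ ^ 2) ^ σ : ℝ) : ℂ) * (herm z w ^ j * (starRingEnd ℂ) (herm z w) ^ k)) := by
    intro w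
    have : herm z (U w) = (starRingEnd ℂ) ξ * herm z w := by
      rw [hU, herm_eq_inner, herm_eq_inner, inner_smul_left]
    rw [this, U.norm_map, ← hprod]
    simp only [map_mul, Complex.conj_conj, mul_pow]
    ring
  simp_rw [e] at h
  rw [integral_const_mul] at h
  set X := ∫ w in unitBall d, ((((1 - ‖w‖ ^ 2) ^ σ : ℝ) : ℂ) * (herm z w ^ j * (starRingEnd ℂ) (herm z w) ^ k)) ∂(normVol d)
  have : (2:ℂ) * X = 0 := by linear_combination -h
  simpa using this

/-- binomial coefficient -/
noncomputable def bc (a : ℝ) (k : ℕ) : ℝ := Real.Gamma (a + k) / (Real.Gamma a * Real.Gamma (k + 1))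

lemma bc_pos {a : ℝ} (ha : 0 < a) (k : ℕ) : 0 < bc a k := by
  have g1 := Real.Gamma_pos_of_pos (s := a + k) (by positivity)
  have g2 := Real.Gamma_pos_of_pos ha
  have g3 := Real.Gamma_pos_of_pos (s := (k:ℝ) + 1) (by positivity)
  unfold bc; positivity

lemma bc_series {a : ℝ} (ha : 0 < a) (u : ℂ) (hu : ‖u‖ < 1) :
    HasSum (fun k => (bc a k : ℂ) * u ^ k) (1 / (1 - u) ^ (a : ℂ)) := by
  have h := (Complex.one_div_one_sub_cpow_hasFPowerSeriesOnBall_zero (a : ℂ)).hasSum (y := u) (by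
    simpa [enorm_eq_nnnorm, ← NNReal.coe_lt_coe] using hu)
  simp only [zero_add, FormalMultilinearSeries.ofScalars_apply_eq, smul_eq_mul] at h
  suffices e : ∀ k : ℕ, (bc a k : ℂ) = Ring.choose ((a:ℂ) + k - 1) k by
    simp_rw [e]; simpa using h
  intro k
  have hp : ∀ m : ℕ, (ascPochhammer ℕ m).smeval a * Real.Gamma a = Real.Gamma (a + m) := by
    intro m
    induction m with
    | zero => simp
    | succ m ih =>
      rw [ascPochhammer_succ_right, Polynomial.smeval_mul, Polynomial.smeval_add, Polynomial.smeval_X,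
        Polynomial.smeval_natCast, mul_right_comm, ih]
      push_cast
      rw [← add_assoc, Real.Gamma_add_one (by positivity)]
      simp [mul_comm]
  have h1 := Ring.factorial_nsmul_multichoose_eq_ascPochhammer a k
  have h2 : Ring.choose ((a:ℂ) + k - 1) k = ((Ring.multichoose a k : ℝ) : ℂ) := by
    rw [Ring.multichoose_eq, Complex.ofReal_choose]; push_cast; rfl
  rw [h2]
  congr 1
  rw [bc, ← hp k, ← h1, Real.Gamma_nat_eq_factorial]
  have := (Real.Gamma_pos_of_pos ha).ne'
  simp only [nsmul_eq_mul]
  field_simp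

lemma J_series (d : ℕ) (hd : 0 < d) (σ : ℝ) (hσ : -1 < σ) (a : ℝ) (ha : 0 < a) (z : Cd d)
    (hz : ‖z‖ < 1) :
    HasSum (fun k : ℕ => bc a k ^ 2 * (‖z‖ ^ (2 * k) * (Real.Gamma (k + 1) * Real.Gamma (σ + 1) * Real.Gamma (d + 1) / Real.Gamma (k + d + σ + 1))))
    (∫ w in unitBall d, (1 - ‖w‖ ^ 2) ^ σ * (‖1 - herm z w‖ ^ (2 * a))⁻¹ ∂(normVol d)) := by
  set μ := (normVol d).restrict (unitBall d) with hμ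
  let F : ℕ × ℕ → Cd d → ℂ := fun p w => ((bc a p.1 * bc a p.2 : ℝ) : ℂ) *
    ((((1 - ‖w‖ ^ 2) ^ σ : ℝ) : ℂ) * (herm z w ^ p.1 * (starRingEnd ℂ) (herm z w) ^ p.2))
  have hball : ∀ᵐ w ∂μ, w ∈ unitBall d := ae_restrict_mem (measurableSet_unitBall d)
  have hu : ∀ w ∈ unitBall d, ‖herm z w‖ ≤ ‖z‖ := by
    intro w hw
    have : ‖w‖ < 1 := by simpa [unitBall] using hw
    exact (norm_herm_le z w).trans (mul_le_of_le_one_right (norm_nonneg _) this.le)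
  have hmeas : ∀ p, AEStronglyMeasurable (F p) μ := by
    intro p
    apply Measurable.aestronglyMeasurable
    have h1 := (measurable_herm z).measurable
    have h2 := Complex.measurable_ofReal.comp (measurable_W d σ)
    have h3 : Measurable (fun w => (starRingEnd ℂ) (herm z w)) := (Complex.continuous_conj.comp (measurable_herm z)).measurable
    exact (h2.mul ((h1.pow_const _).mul (h3.pow_const _))).const_mul _
  have hbound : ∀ p, ∀ w ∈ unitBall d, ‖F p w‖ ≤ (bc a p.1 * ‖z‖ ^ p.1) * (bc a p.2 * ‖z‖ ^ p.2) * (1 - ‖w‖ ^ 2) ^ σ := by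
    intro p w hw
    have b1 := bc_pos ha p.1
    have b2 := bc_pos ha p.2
    have hW := W_nonneg σ hw
    have hh := hu w hw
    simp only [F, norm_mul, norm_pow, Complex.norm_real, RCLike.norm_conj, Real.norm_eq_abs]
    rw [abs_of_pos b1, abs_of_pos b2, abs_of_nonneg hW]
    calc _ ≤ bc a p.1 * bc a p.2 * ((1 - ‖w‖ ^ 2) ^ σ * (‖z‖ ^ p.1 * ‖z‖ ^ p.2)) := by gcongr
      _ = _ := by ring
  have hW := int_W d hd σ hσ
  have hint : ∀ p, Integrable (F p) μ := by
    intro p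
    refine Integrable.mono' (hW.const_mul ((bc a p.1 * ‖z‖ ^ p.1) * (bc a p.2 * ‖z‖ ^ p.2))) (hmeas p) ?_
    filter_upwards [hball] with w hw using hbound p w hw
  have hs1 : Summable (fun k => bc a k * ‖z‖ ^ k) := by
    have := (bc_series ha (‖z‖ : ℂ) (by simpa using hz)).summable
    rw [← Complex.summable_ofReal]
    refine this.congr fun k => ?_
    push_cast; rfl
  have hn1 : ∀ k, 0 ≤ bc a k * ‖z‖ ^ k := fun k => by
    have := bc_pos ha k
    positivity
  have hsum : Summable (fun p => ∫ w, ‖F p w‖ ∂μ) := by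
    have h2 := (hs1.mul_of_nonneg hs1 hn1 hn1).mul_right (∫ w, (1 - ‖w‖ ^ 2) ^ σ ∂μ)
    refine Summable.of_nonneg_of_le (fun p => integral_nonneg fun w => norm_nonneg _) (fun p => ?_) h2
    rw [← integral_const_mul]
    refine integral_mono_ae (hint p).norm (hW.const_mul _) ?_
    filter_upwards [hball] with w hw using hbound p w hw
  have hmain := hasSum_integral_of_summable_integral_norm hint hsum
  have hdiag : ∀ p, p ∉ range (fun k : ℕ => (k, k)) → ∫ w, F p w ∂μ = 0 := by
    intro p hp
    have : p.1 ≠ p.2 := fun h => hp ⟨p.1, by ext <;> simp [h]⟩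
    simp only [F]
    rw [integral_const_mul, orth d σ z _ _ this, mul_zero]
  have hinj : Function.Injective (fun k : ℕ => (k, k)) := fun a b h => by simpa using h
  rw [← hinj.hasSum_iff hdiag] at hmain
  have hterm : ∀ k : ℕ, ∫ w, F (k, k) w ∂μ = ((bc a k ^ 2 * (‖z‖ ^ (2 * k) * (Real.Gamma (k + 1) * Real.Gamma (σ + 1) * Real.Gamma (d + 1) / Real.Gamma (k + d + σ + 1))) : ℝ) : ℂ) := by
    intro k
    simp only [F]
    rw [integral_const_mul, ← moment d hd σ hσ k z, Complex.ofReal_mul (bc a k ^ 2), Complex.ofReal_mul (bc a k), Complex.ofReal_pow (bc a k), ← integral_complex_ofReal, sq]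
    congr 2
    ext w
    rw [← mul_pow, Complex.mul_conj, mul_comm, Complex.normSq_eq_norm_sq, ← Complex.ofReal_pow, ← pow_mul]
    push_cast; rfl
  have hval : ∫ w, ∑' p, F p w ∂μ = ((∫ w, (1 - ‖w‖ ^ 2) ^ σ * (‖1 - herm z w‖ ^ (2 * a))⁻¹ ∂μ : ℝ) : ℂ) := by
    rw [← integral_complex_ofReal]
    refine integral_congr_ae ?_
    filter_upwards [hball] with w hw
    have hu1 : ‖herm z w‖ < 1 := (hu w hw).trans_lt hz
    have hb := bc_series ha (herm z w) hu1
    have hbc : HasSum (fun k => (bc a k : ℂ) * (starRingEnd ℂ) (herm z w) ^ k) ((starRingEnd ℂ) (1 / (1 - herm z w) ^ (a : ℂ))) := by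
      have := hb.map (starRingEnd ℂ) Complex.continuous_conj
      simpa [Function.comp_def] using this
    have hnorm : Summable (fun k => ‖(bc a k : ℂ) * herm z w ^ k‖) := by
      refine Summable.of_nonneg_of_le (fun k => norm_nonneg _) (fun k => ?_) hs1
      rw [norm_mul, norm_pow, Complex.norm_real, Real.norm_of_nonneg (bc_pos ha k).le]
      have := bc_pos ha k
      have := hu w hw
      gcongr
    have hnorm2 : Summable (fun k => ‖(bc a k : ℂ) * (starRingEnd ℂ) (herm z w) ^ k‖) := by
      refine hnorm.congr fun k => ?_
      simp
    have hsm := summable_mul_of_summable_norm hnorm hnorm2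
    have hprod := HasSum.mul hb hbc hsm
    have h3 := hprod.mul_left ((((1 - ‖w‖ ^ 2) ^ σ : ℝ) : ℂ))
    have h4 : ∑' p, F p w = (((1 - ‖w‖ ^ 2) ^ σ : ℝ) : ℂ) * (1 / (1 - herm z w) ^ (a : ℂ) * (starRingEnd ℂ) (1 / (1 - herm z w) ^ (a : ℂ))) := by
      rw [← h3.tsum_eq]
      congr 1
      ext p
      simp only [F]
      push_cast
      ring
    have hne : 1 - herm z w ≠ 0 := by
      intro h0
      have : herm z w = 1 := by linear_combination -h0
      rw [this] at hu1; simp at hu1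
    simp only [h4]
    rw [Complex.mul_conj, Complex.normSq_eq_norm_sq, Complex.ofReal_mul]
    congr 2
    rw [norm_div, norm_one, Complex.norm_cpow_real, div_pow, one_pow, one_div, ← Real.rpow_natCast, ← Real.rpow_mul (norm_nonneg _)]
    congr 2
    push_cast; ring
  rw [hval] at hmain
  rw [← Complex.hasSum_ofReal]
  simp_rw [← hterm]
  exact hmain

end BPS
namespace BPS
open Filter Topology Set

noncomputable def Jf (d : ℕ) (σ s : ℝ) (z : Cd d) : ℝ :=
  ∫ w in unitBall d, (1 - ‖w‖ ^ 2) ^ σ * (‖1 - herm z w‖ ^ s)⁻¹ ∂(normVol d)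

lemma J_asymp (d n : ℕ) (hd : 0 < d) (hn : 0 < n) (σ : ℝ) (hσ : -1 < σ) :
    (∃ M, ∀ z ∈ unitBall d, (1 - ‖z‖ ^ 2) ^ n * Jf d σ (d + 1 + σ + n) z ≤ M) ∧
    ∀ zs : ℕ → Cd d, (∀ m, zs m ∈ unitBall d) → Tendsto (fun m => ‖zs m‖ ^ 2) atTop (𝓝 1) →
      Tendsto (fun m => (1 - ‖zs m‖ ^ 2) ^ n * Jf d σ (d + 1 + σ + n) (zs m)) atTop
        (𝓝 (Real.Gamma (σ + 1) * Real.Gamma (d + 1) / Real.Gamma ((d + 1 + σ + n) / 2) ^ 2 * Real.Gamma n)) := by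
  have hd' : (0:ℝ) < d := by exact_mod_cast hd
  have hl : (0:ℝ) < d + 1 + σ := by linarith
  have ha : (0:ℝ) < (d + 1 + σ + n) / 2 := by positivity
  set l : ℝ := d + 1 + σ with hldef
  set a : ℝ := (l + n) / 2 with hadef
  set A : ℕ → ℝ := fun k => (Real.Gamma (a + k)) ^ 2 / (Real.Gamma (k + 1) * Real.Gamma (k + l)) with hA
  set C : ℝ := Real.Gamma (σ + 1) * Real.Gamma (d + 1) / Real.Gamma a ^ 2 with hC
  have hCpos : 0 < C := by
    have g1 := Real.Gamma_pos_of_pos (s := (d:ℝ) + 1) (by positivity)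
    have g2 := Real.Gamma_pos_of_pos (s := σ + 1) (by linarith)
    have g3 := Real.Gamma_pos_of_pos ha
    positivity
  have hA0 : ∀ k, 0 ≤ A k := fun k => by
    have g2 := Real.Gamma_pos_of_pos (s := (k:ℝ) + 1) (by positivity)
    have g3 := Real.Gamma_pos_of_pos (s := (k:ℝ) + l) (by positivity)
    simp only [hA]; positivity
  obtain ⟨⟨M, hM⟩, hT⟩ := abel n hn A hA0 _ (ratio_tendsto n hn l hl)
  have hJ : ∀ z ∈ unitBall d, Jf d σ (l + n) z = C * ∑' k, A k * (‖z‖ ^ 2) ^ k := by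
    intro z hz
    have hz' : ‖z‖ < 1 := by simpa [unitBall] using hz
    have h := J_series d hd σ hσ a ha z hz'
    have e2 : 2 * a = l + n := by rw [hadef]; ring
    rw [e2] at h
    rw [Jf, ← h.tsum_eq, ← tsum_mul_left]
    congr 1
    ext k
    have g2 := Real.Gamma_pos_of_pos (s := (k:ℝ) + 1) (by positivity)
    have g3 := Real.Gamma_pos_of_pos (s := (k:ℝ) + l) (by positivity)
    have g4 := Real.Gamma_pos_of_pos ha
    rw [show (k:ℝ) + d + σ + 1 = k + l by rw [hldef]; ring]
    simp only [hA, hC, bc, pow_mul]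
    field_simp
  refine ⟨⟨C * M, fun z hz => ?_⟩, fun zs hzs ht => ?_⟩
  · have hz' : ‖z‖ < 1 := by simpa [unitBall] using hz
    rw [hJ z hz]
    have := (hM (‖z‖ ^ 2) (by positivity) (by nlinarith [norm_nonneg z])).2
    calc _ = C * ((1 - ‖z‖ ^ 2) ^ n * ∑' k, A k * (‖z‖ ^ 2) ^ k) := by ring
      _ ≤ _ := by gcongr
  · have h1 : Tendsto (fun m => ‖zs m‖ ^ 2) atTop (𝓝[Ico 0 1] 1) := by
      refine tendsto_nhdsWithin_iff.2 ⟨ht, Eventually.of_forall fun m => ?_⟩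
      have hz' : ‖zs m‖ < 1 := by simpa [unitBall] using hzs m
      exact ⟨by positivity, by nlinarith [norm_nonneg (zs m)]⟩
    refine ((hT.comp h1).const_mul C).congr fun m => ?_
    rw [hJ _ (hzs m)]
    simp only [Function.comp]
    ring

noncomputable def If (d : ℕ) (s : ℝ) (H : Cd d → ℂ) (z : Cd d) : ℂ :=
  ∫ w in unitBall d, H w / (1 - herm z w) ^ (s : ℂ) ∂(normVol d)

lemma re_pos {d : ℕ} {z w : Cd d} {R : ℝ} (hz : ‖z‖ ≤ R) (hR : R < 1) (hw : w ∈ unitBall d) :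
    1 - R ≤ ‖1 - herm z w‖ ∧ (1 - herm z w) ∈ slitPlane := by
  have hw' : ‖w‖ < 1 := by simpa [unitBall] using hw
  have h1 : ‖herm z w‖ ≤ R := (norm_herm_le z w).trans
    ((mul_le_of_le_one_right (norm_nonneg _) hw'.le).trans hz)
  have h2 : 1 - R ≤ (1 - herm z w).re := by
    have := (Complex.abs_re_le_norm (herm z w))
    have := le_abs_self (herm z w).re
    simp; linarith
  exact ⟨h2.trans ((le_abs_self _).trans (Complex.abs_re_le_norm _)), Or.inl (by linarith)⟩

lemma norm_ker_le {u : ℂ} {R s : ℝ} (hR : 0 < R) (hs : 0 ≤ s) (hu : R ≤ ‖u‖) (H : ℂ) :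
    ‖H / u ^ (s : ℂ)‖ ≤ ‖H‖ * (R ^ s)⁻¹ := by
  rw [norm_div, Complex.norm_cpow_real, div_eq_mul_inv]
  gcongr

lemma pd_If (d : ℕ) (s : ℝ) (hs : 0 < s) (H : Cd d → ℂ) (hH : IntegrableOn H (unitBall d) (normVol d))
    (j : Fin d) (z : Cd d) (hz : z ∈ unitBall d) :
    pd d j (If d s H) z = s * If d (s + 1) (fun w => (starRingEnd ℂ) (w j) * H w) z := by
  set μ := (normVol d).restrict (unitBall d) with hμ
  have hball : ∀ᵐ w ∂μ, w ∈ unitBall d := ae_restrict_mem (measurableSet_unitBall d)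
  have hz' : ‖z‖ < 1 := by simpa [unitBall] using hz
  set R := (1 + ‖z‖) / 2 with hR
  have hR1 : R < 1 := by rw [hR]; linarith
  have hzR : ‖z‖ < R := by rw [hR]; linarith
  have hHm : AEStronglyMeasurable H μ := hH.aestronglyMeasurable
  let F' : Cd d → Cd d → (Cd d →L[ℂ] ℂ) := fun x w => ((s : ℂ) * (H w / (1 - herm x w) ^ ((s + 1 : ℝ) : ℂ))) • innerSL ℂ w
  have hmeasK : ∀ (t : ℝ) (x : Cd d), Measurable (fun w => (1 - herm x w) ^ (t : ℂ)) := fun t x =>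
    ((measurable_const.sub (measurable_herm x).measurable).pow_const _)
  have hFm : ∀ (t : ℝ) (x : Cd d), AEStronglyMeasurable (fun w => H w / (1 - herm x w) ^ (t : ℂ)) μ := fun t x =>
    (hHm.aemeasurable.div (hmeasK t x).aemeasurable).aestronglyMeasurable
  have hnear : Metric.ball (0 : Cd d) R ∈ 𝓝 z := Metric.isOpen_ball.mem_nhds (by simpa using hzR)
  have hFint : ∀ t : ℝ, 0 ≤ t → Integrable (fun w => H w / (1 - herm z w) ^ (t : ℂ)) μ := by
    intro t ht
    refine Integrable.mono' (hH.norm.mul_const (((1 - R) ^ t)⁻¹)) (hFm t z) ?_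
    filter_upwards [hball] with w hw
    exact norm_ker_le (by linarith) ht (re_pos hzR.le hR1 hw).1 _
  have hF'm : AEStronglyMeasurable (F' z) μ := by
    refine ((hFm (s + 1) z).const_mul (s : ℂ)).smul ?_
    exact (innerSL ℂ (E := Cd d)).continuous.aestronglyMeasurable
  have hbd : ∀ᵐ w ∂μ, ∀ x ∈ Metric.ball (0 : Cd d) R, ‖F' x w‖ ≤ s * (‖H w‖ * ((1 - R) ^ (s + 1))⁻¹) := by
    filter_upwards [hball] with w hw x hx
    have hx : ‖x‖ < R := by simpa using hx
    have hw' : ‖w‖ < 1 := by simpa [unitBall] using hw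
    have h1 := norm_ker_le (s := s + 1) (by linarith) (by linarith) (re_pos hx.le hR1 hw).1 (H w)
    simp only [F']
    rw [norm_smul, norm_mul, innerSL_apply_norm, Complex.norm_real, Real.norm_of_nonneg hs.le]
    refine (mul_le_of_le_one_right (by positivity) hw'.le).trans ?_
    gcongr
  have hbi : Integrable (fun w => s * (‖H w‖ * ((1 - R) ^ (s + 1))⁻¹)) μ :=
    (hH.norm.mul_const _).const_mul _
  have hdiff : ∀ᵐ w ∂μ, ∀ x ∈ Metric.ball (0 : Cd d) R,
      HasFDerivAt (fun x => H w / (1 - herm x w) ^ (s : ℂ)) (F' x w) x := by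
    filter_upwards [hball] with w hw x hx
    have hx : ‖x‖ < R := by simpa using hx
    have hsl := (re_pos hx.le hR1 hw).2
    have hne : (1 - herm x w) ≠ 0 := Complex.slitPlane_ne_zero hsl
    have h1 : HasFDerivAt (fun x => 1 - herm x w) (-(innerSL ℂ w)) x := by
      have : (fun x => 1 - herm x w) = fun x => 1 - innerSL ℂ w x := by
        ext x; rw [herm_eq_inner]; rfl
      rw [this]
      exact ((innerSL ℂ w).hasFDerivAt).const_sub 1
    have h2 : HasDerivAt (fun u : ℂ => H w * u ^ (-(s:ℂ))) (H w * (-(s:ℂ) * (1 - herm x w) ^ (-(s:ℂ) - 1))) (1 - herm x w) :=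
      (by simpa using (hasDerivAt_id (1 - herm x w)).cpow_const (c := -(s:ℂ)) hsl :
        HasDerivAt (fun u : ℂ => u ^ (-(s:ℂ))) (-(s:ℂ) * (1 - herm x w) ^ (-(s:ℂ) - 1)) (1 - herm x w)).const_mul _
    have h3 := h2.comp_hasFDerivAt x h1
    have e1 : (fun x => H w / (1 - herm x w) ^ (s : ℂ)) = (fun u : ℂ => H w * u ^ (-(s:ℂ))) ∘ (fun x => 1 - herm x w) := by
      ext x; simp only [Function.comp]; rw [Complex.cpow_neg, div_eq_mul_inv]
    rw [e1]
    have e2 : F' x w = (H w * (-(s:ℂ) * (1 - herm x w) ^ (-(s:ℂ) - 1))) • -(innerSL ℂ w) := by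
      simp only [F']
      rw [smul_neg, ← neg_smul]
      congr 1
      rw [show -(s:ℂ) - 1 = -((s + 1 : ℝ) : ℂ) by push_cast; ring, Complex.cpow_neg]
      ring
    rw [e2]
    exact h3
  have hmain := hasFDerivAt_integral_of_dominated_of_fderiv_le (𝕜 := ℂ) hnear
    (Eventually.of_forall fun x => hFm s x) (hFint s hs.le) hF'm hbd hbi hdiff
  have hF'int : Integrable (F' z) μ := by
    refine Integrable.mono' hbi hF'm ?_
    filter_upwards [hbd] with w hw using hw z (by simpa using hzR)
  rw [pd]
  have : fderiv ℂ (If d s H) z = ∫ w, F' z w ∂μ := hmain.fderiv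
  rw [this, ContinuousLinearMap.integral_apply hF'int, If, ← integral_const_mul]
  congr 1
  ext w
  have e3 : inner ℂ w (EuclideanSpace.single j (1:ℂ)) = (starRingEnd ℂ) (w j) := by
    simp [EuclideanSpace.inner_single_right]
  simp only [F', _root_.smul_apply, innerSL_apply_apply, smul_eq_mul]
  rw [e3]
  ring

end BPS

namespace BPS
open Filter Topology Set

def Rep (d : ℕ) (c : ℂ) (s0 : ℝ) (g : Cd d → ℂ) (m : ℕ) (H : Cd d → ℂ) : Prop :=
  IntegrableOn H (unitBall d) (normVol d) ∧
    ∀ z ∈ unitBall d, g z = (c * (Real.Gamma (s0 + m) : ℂ)) * If d (s0 + m) H z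

lemma Rep.step {d : ℕ} {c : ℂ} {s0 : ℝ} {g : Cd d → ℂ} {m : ℕ} {H : Cd d → ℂ} (hs : 0 < s0)
    (h : Rep d c s0 g m H) (j : Fin d) :
    Rep d c s0 (pd d j g) (m + 1) (fun w => (starRingEnd ℂ) (w j) * H w) := by
  obtain ⟨hH, hg⟩ := h
  have hpos : 0 < s0 + m := by positivity
  constructor
  · refine Integrable.mono' hH.norm ?_ ?_
    · refine AEStronglyMeasurable.mul ?_ hH.aestronglyMeasurable
      have : Continuous (fun w : Cd d => (starRingEnd ℂ) (w j)) := by fun_prop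
      exact this.aestronglyMeasurable
    · filter_upwards [ae_restrict_mem (measurableSet_unitBall d)] with w hw
      have hw' : ‖w‖ < 1 := by simpa [unitBall] using hw
      rw [norm_mul, RCLike.norm_conj]
      exact mul_le_of_le_one_left (norm_nonneg _) ((PiLp.norm_apply_le w j).trans hw'.le)
  · intro z hz
    have he : g =ᶠ[𝓝 z] fun z => (c * (Real.Gamma (s0 + m) : ℂ)) * If d (s0 + m) H z := by
      have : unitBall d ∈ 𝓝 z := Metric.isOpen_ball.mem_nhds hz
      filter_upwards [this] with x hx using hg x hx
    have e1 : pd d j g z = (c * (Real.Gamma (s0 + m) : ℂ)) * pd d j (If d (s0 + m) H) z := by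
      rw [pd, pd, he.fderiv_eq]
      have := fderiv_const_smul_field (𝕜 := ℂ) (c * (Real.Gamma (s0 + m) : ℂ)) (f := If d (s0 + m) H)
      have h2 : (fun z => (c * (Real.Gamma (s0 + m) : ℂ)) * If d (s0 + m) H z) = (c * (Real.Gamma (s0 + m) : ℂ)) • If d (s0 + m) H := rfl
      rw [h2, this]
      rfl
    rw [e1, pd_If d _ hpos H hH j z hz]
    have e2 : s0 + ((m + 1 : ℕ) : ℝ) = s0 + m + 1 := by push_cast; ring
    rw [e2, Real.Gamma_add_one hpos.ne']
    push_cast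
    ring

lemma Rep.congr {d : ℕ} {c : ℂ} {s0 : ℝ} {g : Cd d → ℂ} {m m' : ℕ} {H H' : Cd d → ℂ}
    (h : Rep d c s0 g m H) (hm : m = m') (hH : H = H') : Rep d c s0 g m' H' := by
  subst hm hH; exact h

lemma Rep.iter {d : ℕ} {c : ℂ} {s0 : ℝ} {g : Cd d → ℂ} {m : ℕ} {H : Cd d → ℂ} (hs : 0 < s0)
    (h : Rep d c s0 g m H) (j : Fin d) (p : ℕ) :
    Rep d c s0 ((pd d j)^[p] g) (p + m) (fun w => (starRingEnd ℂ) (w j) ^ p * H w) := by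
  induction p with
  | zero => simpa using h
  | succ p ih =>
    rw [Function.iterate_succ_apply']
    refine (ih.step hs j).congr (by ring) ?_
    ext w; ring

lemma Rep.fold {d : ℕ} {c : ℂ} {s0 : ℝ} {g : Cd d → ℂ} {m : ℕ} {H : Cd d → ℂ} (hs : 0 < s0)
    (h : Rep d c s0 g m H) (α : Fin d → ℕ) (l : List (Fin d)) :
    Rep d c s0 (l.foldr (fun j g => (pd d j)^[α j] g) g) ((l.map α).sum + m)
      (fun w => (l.map (fun j => (starRingEnd ℂ) (w j) ^ α j)).prod * H w) := by
  induction l with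
  | nil => simpa using h
  | cons j l ih =>
    rw [List.foldr_cons]
    refine (ih.iter hs j (α j)).congr ?_ ?_
    · simp; ring
    · ext w; simp; ring

lemma int_WG (d : ℕ) (hd : 0 < d) (σ : ℝ) (hσ : -1 < σ) (G : Cd d → ℂ) (hG : Measurable G)
    (hG1 : ∀ w, ‖G w‖ ≤ 1) :
    IntegrableOn (fun w => (((1 - ‖w‖ ^ 2 : ℝ) ^ σ : ℝ) : ℂ) * G w) (unitBall d) (normVol d) := by
  have hW := int_W d hd σ hσ
  refine Integrable.mono' hW.norm ?_ ?_
  · exact hW.ofReal.aestronglyMeasurable.mul hG.aestronglyMeasurable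
  · refine Eventually.of_forall fun w => ?_
    rw [norm_mul, Complex.norm_real]
    exact mul_le_of_le_one_right (norm_nonneg _) (hG1 w)

lemma Dmap_eq (d n : ℕ) (hd : 0 < d) (σ : ℝ) (hσ : -1 < σ) (G : Cd d → ℂ) (hG : Measurable G)
    (hG1 : ∀ w, ‖G w‖ ≤ 1) (z : Cd d) (hz : z ∈ unitBall d) (α : MIdx d n) :
    Dmap d n (bergman d σ G) z α =
      ((Real.Gamma (d + 1 + σ + n) / (Real.Gamma (σ + 1) * Real.Gamma (d + 1)) : ℝ) : ℂ) *
        If d (d + 1 + σ + n) (fun w => (starRingEnd ℂ) (Zmap d n w α) *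
          ((((1 - ‖w‖ ^ 2 : ℝ) ^ σ : ℝ) : ℂ) * G w)) z := by
  have hs : (0:ℝ) < d + 1 + σ := by
    have : (0:ℝ) ≤ d := by positivity
    linarith
  have hΓ : (Real.Gamma (d + 1 + σ) : ℂ) ≠ 0 := by
    exact_mod_cast (Real.Gamma_pos_of_pos hs).ne'
  have h0 : Rep d ((cCoef d σ : ℂ) / (Real.Gamma (d + 1 + σ) : ℂ)) (d + 1 + σ) (bergman d σ G) 0
      (fun w => (((1 - ‖w‖ ^ 2 : ℝ) ^ σ : ℝ) : ℂ) * G w) := by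
    refine ⟨int_WG d hd σ hσ G hG hG1, fun z _ => ?_⟩
    rw [bergman, Nat.cast_zero, add_zero, div_mul_cancel₀ _ hΓ, If]
    congr 2
    ext w
    rw [bergKer]
    ring
  have h1 := (h0.fold hs α.1 (List.finRange d)).2 z hz
  have hsum : ((List.finRange d).map α.1).sum + 0 = n := by
    rw [add_zero, ← Fin.sum_univ_def]; exact α.2
  rw [hsum] at h1
  rw [Dmap, mpd, h1]
  congr 1
  · rw [cCoef, show (d:ℝ) + σ + 1 = d + 1 + σ by ring]
    push_cast
    field_simp
  · congr 1
    ext w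
    rw [Zmap, map_prod, Fin.prod_univ_def]
    simp only [map_pow]

lemma int_J (d : ℕ) (hd : 0 < d) (σ : ℝ) (hσ : -1 < σ) (s : ℝ) (hs : 0 ≤ s) (z : Cd d)
    (hz : z ∈ unitBall d) :
    IntegrableOn (fun w => (1 - ‖w‖ ^ 2) ^ σ * (‖1 - herm z w‖ ^ s)⁻¹) (unitBall d) (normVol d) := by
  have hz' : ‖z‖ < 1 := by simpa [unitBall] using hz
  have hW := int_W d hd σ hσ
  refine Integrable.mono' (hW.mul_const (((1 - ‖z‖) ^ s)⁻¹)) ?_ ?_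
  · refine hW.aestronglyMeasurable.mul ?_
    exact (((measurable_const.sub (measurable_herm z).measurable).norm.pow_const s).inv).aestronglyMeasurable
  · filter_upwards [ae_restrict_mem (measurableSet_unitBall d)] with w hw
    have h1 := (re_pos le_rfl hz' hw).1
    have h2 : 0 < 1 - ‖z‖ := by linarith
    have h3 := W_nonneg σ hw
    rw [Real.norm_of_nonneg (by positivity)]
    gcongr

lemma norm_Z_le (d n : ℕ) (w : Cd d) (hw : ‖w‖ ≤ 1) (α : MIdx d n) : ‖Zmap d n w α‖ ≤ 1 := by
  rw [Zmap, norm_prod]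
  refine Finset.prod_le_one (fun _ _ => norm_nonneg _) fun j _ => ?_
  rw [norm_pow]
  exact pow_le_one₀ (norm_nonneg _) ((PiLp.norm_apply_le w j).trans hw)

lemma norm_Dmap_le (d n : ℕ) (hd : 0 < d) (σ : ℝ) (hσ : -1 < σ) (G : Cd d → ℂ) (hG : Measurable G)
    (hG1 : ∀ w, ‖G w‖ ≤ 1) (z : Cd d) (hz : z ∈ unitBall d) (α : MIdx d n) :
    ‖Dmap d n (bergman d σ G) z α‖ ≤
      (Real.Gamma (d + 1 + σ + n) / (Real.Gamma (σ + 1) * Real.Gamma (d + 1))) *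
        Jf d σ (d + 1 + σ + n) z := by
  have hs : (0:ℝ) < d + 1 + σ + n := by
    have : (0:ℝ) ≤ d := by positivity
    have : (0:ℝ) ≤ n := by positivity
    linarith
  have hC : 0 ≤ Real.Gamma (d + 1 + σ + n) / (Real.Gamma (σ + 1) * Real.Gamma (d + 1)) := by
    have h1 := Real.Gamma_pos_of_pos hs
    have h2 := Real.Gamma_pos_of_pos (show 0 < σ + 1 by linarith)
    have h3 := Real.Gamma_pos_of_pos (show (0:ℝ) < d + 1 by positivity)
    positivity
  rw [Dmap_eq d n hd σ hσ G hG hG1 z hz α, norm_mul, Complex.norm_real, Real.norm_of_nonneg hC]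
  gcongr
  rw [If, Jf]
  refine norm_integral_le_of_norm_le (int_J d hd σ hσ _ hs.le z hz) ?_
  filter_upwards [ae_restrict_mem (measurableSet_unitBall d)] with w hw
  have hw' : ‖w‖ < 1 := by simpa [unitBall] using hw
  rw [norm_div, norm_mul, norm_mul, Complex.norm_cpow_real, Complex.norm_real, RCLike.norm_conj,
    Real.norm_of_nonneg (W_nonneg σ hw), div_eq_mul_inv]
  gcongr
  have h1 := norm_Z_le d n w hw'.le α
  have h3 := W_nonneg σ hw
  calc ‖Zmap d n w α‖ * ((1 - ‖w‖ ^ 2) ^ σ * ‖G w‖) ≤ 1 * ((1 - ‖w‖ ^ 2) ^ σ * 1) := by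
        gcongr; exact hG1 w
    _ = _ := by ring

lemma N_le {ι : Type*} [Fintype ι] (N : (ι → ℂ) → ℝ)
    (hN_add : ∀ x y, N (x + y) ≤ N x + N y)
    (hN_smul : ∀ (c : ℂ) (x), N (c • x) = ‖c‖ * N x) :
    ∃ K : ι → ℝ, ∀ x, N x ≤ ∑ i, ‖x i‖ * K i := by
  classical
  have h0 : N 0 = 0 := by simpa using hN_smul 0 0
  refine ⟨fun i => N (Pi.single i 1), fun x => ?_⟩
  have hsum : ∀ (s : Finset ι) (f : ι → ι → ℂ), N (∑ i ∈ s, f i) ≤ ∑ i ∈ s, N (f i) := by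
    intro s f
    induction s using Finset.induction_on with
    | empty => simp [h0]
    | insert a s ha ih =>
      rw [Finset.sum_insert ha, Finset.sum_insert ha]
      exact (hN_add _ _).trans (by gcongr)
  have hx : x = ∑ i, x i • (Pi.single i (1:ℂ) : ι → ℂ) := by
    ext k
    simp [Finset.sum_apply, Pi.single_apply]
  calc N x = N (∑ i, x i • (Pi.single i (1:ℂ) : ι → ℂ)) := by rw [← hx]
    _ ≤ _ := (hsum _ _).trans (by simp only [hN_smul]; exact le_rfl)

lemma N_cont {ι : Type*} [Fintype ι] (N : (ι → ℂ) → ℝ)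
    (hN_add : ∀ x y, N (x + y) ≤ N x + N y)
    (hN_smul : ∀ (c : ℂ) (x), N (c • x) = ‖c‖ * N x) : Continuous N := by
  obtain ⟨K, hK⟩ := N_le N hN_add hN_smul
  rw [continuous_iff_continuousAt]
  intro x
  have hneg : ∀ y, N (-y) = N y := fun y => by simpa using hN_smul (-1) y
  have key : ∀ y, |N y - N x| ≤ ∑ i, ‖y i - x i‖ * K i := by
    intro y
    have h1 := hN_add (y - x) x
    have h2 := hN_add (x - y) y
    have h3 := hneg (y - x)
    rw [neg_sub] at h3
    rw [sub_add_cancel] at h1 h2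
    have h4 := hK (y - x)
    simp only [Pi.sub_apply] at h4
    rw [abs_le]
    constructor <;> linarith
  rw [ContinuousAt, tendsto_iff_dist_tendsto_zero]
  refine squeeze_zero (g := fun y => ∑ i, ‖y i - x i‖ * K i) (fun _ => dist_nonneg) (fun y => by rw [Real.dist_eq]; exact key y) ?_
  have : Continuous (fun y : ι → ℂ => ∑ i, ‖y i - x i‖ * K i) := by fun_prop
  simpa using this.tendsto x

end BPS

namespace BPS
open Filter Topology Set

lemma herm_smul {d : ℕ} (r : ℝ) (ζ w : Cd d) : herm ((r : ℂ) • ζ) w = r * herm ζ w := by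
  simp only [herm, Finset.mul_sum, PiLp.smul_apply, smul_eq_mul, mul_assoc]

lemma far_bound {d : ℕ} {ζ w : Cd d} {r δ : ℝ} (hζ : ‖ζ‖ = 1) (hw : ‖w‖ < 1) (hr0 : 0 < r)
    (hr1 : r < 1) (hδ : 0 < δ) (h : δ ≤ ‖w - ζ‖) :
    min 1 (δ ^ 2 / 2) ≤ ‖1 - herm ((r : ℂ) • ζ) w‖ := by
  have h1 := norm_sub_sq (𝕜 := ℂ) w ζ
  rw [← herm_eq_inner, hζ] at h1
  have h2 : ‖w‖ ^ 2 ≤ 1 := pow_le_one₀ (norm_nonneg _) hw.le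
  have h3 : δ ^ 2 ≤ ‖w - ζ‖ ^ 2 := by gcongr
  have h4 : (herm ζ w).re ≤ 1 - δ ^ 2 / 2 := by
    have : RCLike.re (herm ζ w) = (herm ζ w).re := rfl
    rw [this] at h1
    linarith
  have h5 : (1 - herm ((r : ℂ) • ζ) w).re = 1 - r * (herm ζ w).re := by
    rw [herm_smul]; simp
  refine le_trans ?_ (Complex.re_le_norm _)
  rw [h5]
  rcases le_total (herm ζ w).re 0 with h6 | h6
  · exact (min_le_left _ _).trans (by nlinarith)
  · exact (min_le_right _ _).trans (by nlinarith)

lemma conc (d n : ℕ) (hd : 0 < d) (hn : 0 < n) (σ : ℝ) (hσ : -1 < σ) (ζ : Cd d) (hζ : ‖ζ‖ = 1)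
    (r : ℕ → ℝ) (hr0 : ∀ m, 0 < r m) (hr1 : ∀ m, r m < 1) (hr : Tendsto r atTop (𝓝 1))
    (h : Cd d → ℂ) (hc : Continuous h) (hb : ∀ w, ‖w‖ ≤ 1 → ‖h w‖ ≤ 1) :
    Tendsto (fun m => (((1 - r m ^ 2) ^ n : ℝ) : ℂ) * ∫ w in unitBall d,
        (((1 - ‖w‖ ^ 2) ^ σ * (‖1 - herm ((r m : ℂ) • ζ) w‖ ^ ((d:ℝ) + 1 + σ + n))⁻¹ : ℝ) : ℂ) * h w ∂(normVol d))
      atTop (𝓝 (((Real.Gamma (σ + 1) * Real.Gamma (d + 1) / Real.Gamma ((d + 1 + σ + n) / 2) ^ 2 * Real.Gamma n : ℝ) : ℂ) * h ζ)) := by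
  obtain ⟨⟨M, hM⟩, hlim⟩ := J_asymp d n hd hn σ hσ
  set s : ℝ := (d:ℝ) + 1 + σ + n with hs_def
  have hs : 0 < s := by
    have : (0:ℝ) ≤ d := by positivity
    have : (0:ℝ) ≤ n := by positivity
    rw [hs_def]; linarith
  set μ := (normVol d).restrict (unitBall d) with hμ
  have hball : ∀ᵐ w ∂μ, w ∈ unitBall d := ae_restrict_mem (measurableSet_unitBall d)
  set zs : ℕ → Cd d := fun m => (r m : ℂ) • ζ with hzs
  have hnz : ∀ m, ‖zs m‖ = r m := by
    intro m
    rw [hzs]; simp only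
    rw [norm_smul, hζ, Complex.norm_real, Real.norm_of_nonneg (hr0 m).le, mul_one]
  have hzb : ∀ m, zs m ∈ unitBall d := by
    intro m
    simp only [unitBall, Metric.mem_ball, dist_zero_right, hnz]
    exact hr1 m
  have hrp : ∀ m, 0 ≤ (1 - r m ^ 2) ^ n := fun m =>
    pow_nonneg (by nlinarith [hr0 m, hr1 m]) n
  have hA := hlim zs hzb (by simp only [hnz]; simpa using hr.pow 2)
  simp only [hnz] at hA
  let k : ℕ → Cd d → ℝ := fun m w => (1 - ‖w‖ ^ 2) ^ σ * (‖1 - herm (zs m) w‖ ^ s)⁻¹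
  have hk : ∀ m, Integrable (k m) μ := fun m => int_J d hd σ hσ s hs.le (zs m) (hzb m)
  have hW : Integrable (fun w : Cd d => (1 - ‖w‖ ^ 2) ^ σ) μ := int_W d hd σ hσ
  have hkh : ∀ m, Integrable (fun w => ((k m w : ℝ) : ℂ) * h w) μ := by
    intro m
    refine Integrable.mono' (hk m).norm ((hk m).ofReal.aestronglyMeasurable.mul hc.aestronglyMeasurable) ?_
    filter_upwards [hball] with w hw
    have hw' : ‖w‖ < 1 := by simpa [unitBall] using hw
    rw [norm_mul, Complex.norm_real]
    exact mul_le_of_le_one_right (norm_nonneg _) (hb w hw'.le)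
  have hkc : ∀ m, Integrable (fun w => ((k m w : ℝ) : ℂ) * h ζ) μ := fun m => (hk m).ofReal.mul_const _
  have hJ : ∀ m, ∫ w, ((k m w : ℝ) : ℂ) * h ζ ∂μ = ((Jf d σ s (zs m) : ℝ) : ℂ) * h ζ := by
    intro m
    rw [integral_mul_const, integral_complex_ofReal]
    rfl
  set E : ℕ → ℂ := fun m => (((1 - r m ^ 2) ^ n : ℝ) : ℂ) * ∫ w, ((k m w : ℝ) : ℂ) * (h w - h ζ) ∂μ with hE
  have hE0 : Tendsto E atTop (𝓝 0) := by
    rw [Metric.tendsto_atTop]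
    intro ε hε
    have hM0 : 0 ≤ M := by
      refine le_trans ?_ (hM (zs 0) (hzb 0))
      rw [hnz]
      refine mul_nonneg (hrp 0) ?_
      refine integral_nonneg_of_ae ?_
      filter_upwards [hball] with w hw
      have := W_nonneg σ hw
      simp only [Pi.zero_apply]
      positivity
    set e := ε / (2 * (M + 1)) with he
    have he0 : 0 < e := by positivity
    obtain ⟨δ, hδ, hcδ⟩ := Metric.continuous_iff.1 hc ζ e he0
    set a := min 1 (δ ^ 2 / 2) with ha
    have ha0 : 0 < a := lt_min one_pos (by positivity)
    set I := ∫ w, (1 - ‖w‖ ^ 2) ^ σ ∂μ with hI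
    set C := 2 * (a ^ s)⁻¹ with hC
    have hptw : ∀ m, ∀ᵐ w ∂μ, ‖((k m w : ℝ) : ℂ) * (h w - h ζ)‖ ≤ e * k m w + C * (1 - ‖w‖ ^ 2) ^ σ := by
      intro m
      filter_upwards [hball] with w hw
      have hw' : ‖w‖ < 1 := by simpa [unitBall] using hw
      have hWn := W_nonneg σ hw
      have hkn : 0 ≤ k m w := by simp only [k]; positivity
      rw [norm_mul, Complex.norm_real, Real.norm_of_nonneg hkn]
      rcases lt_or_ge ‖w - ζ‖ δ with hlt | hge
      · have h1 := hcδ w (by rwa [dist_eq_norm])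
        rw [dist_eq_norm] at h1
        have h2 : k m w * ‖h w - h ζ‖ ≤ k m w * e := by gcongr
        have h3 : 0 ≤ C * (1 - ‖w‖ ^ 2) ^ σ := by positivity
        linarith
      · have h1 := far_bound hζ hw' (hr0 m) (hr1 m) hδ hge
        have h2 : ‖h w - h ζ‖ ≤ 2 := by
          have := norm_sub_le (h w) (h ζ)
          have := hb w hw'.le
          have := hb ζ hζ.le
          linarith
        have h3 : k m w ≤ (1 - ‖w‖ ^ 2) ^ σ * (a ^ s)⁻¹ := by
          simp only [k]
          gcongr
        have h4 : k m w * ‖h w - h ζ‖ ≤ ((1 - ‖w‖ ^ 2) ^ σ * (a ^ s)⁻¹) * 2 := by gcongr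
        have h5 : 0 ≤ e * k m w := by positivity
        rw [hC]
        linarith
    have hEb : ∀ m, ‖E m‖ ≤ e * M + (1 - r m ^ 2) ^ n * (C * I) := by
      intro m
      have h1 := norm_integral_le_of_norm_le (((hk m).const_mul e).add (hW.const_mul C)) (hptw m)
      have h2 : ∫ w, (e * k m w + C * (1 - ‖w‖ ^ 2) ^ σ) ∂μ = e * Jf d σ s (zs m) + C * I := by
        rw [integral_add ((hk m).const_mul e) (hW.const_mul C), integral_const_mul, integral_const_mul]
        rfl
      have h3 := hM (zs m) (hzb m)
      rw [hnz] at h3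
      simp only [hE]
      rw [norm_mul, Complex.norm_real, Real.norm_of_nonneg (hrp m)]
      have h4 : ‖∫ w, ((k m w : ℝ) : ℂ) * (h w - h ζ) ∂μ‖ ≤ e * Jf d σ s (zs m) + C * I := h2 ▸ h1
      calc _ ≤ (1 - r m ^ 2) ^ n * (e * Jf d σ s (zs m) + C * I) := mul_le_mul_of_nonneg_left h4 (hrp m)
        _ = e * ((1 - r m ^ 2) ^ n * Jf d σ s (zs m)) + (1 - r m ^ 2) ^ n * (C * I) := by ring
        _ ≤ _ := by gcongr
    have hz0 : Tendsto (fun m => (1 - r m ^ 2) ^ n * (C * I)) atTop (𝓝 0) := by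
      have := (((hr.pow 2).const_sub 1).pow n).mul_const (C * I)
      simpa [hn.ne'] using this
    have heM : e * M < ε / 2 := by
      rw [he, div_mul_eq_mul_div, div_lt_div_iff₀ (by positivity) (by norm_num)]
      nlinarith
    obtain ⟨m0, hm0⟩ := Metric.tendsto_atTop.1 hz0 (ε / 2) (by positivity)
    refine ⟨m0, fun m hm => ?_⟩
    have h1 := hm0 m hm
    rw [Real.dist_eq, sub_zero] at h1
    have h2 := (abs_lt.1 h1).2
    rw [dist_zero_right]
    have := hEb m
    linarith
  have hA' : Tendsto (fun m => (((1 - r m ^ 2) ^ n * Jf d σ s (zs m) : ℝ) : ℂ) * h ζ) atTop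
      (𝓝 (((Real.Gamma (σ + 1) * Real.Gamma (d + 1) / Real.Gamma (s / 2) ^ 2 * Real.Gamma n : ℝ) : ℂ) * h ζ)) :=
    ((Complex.continuous_ofReal.tendsto _).comp hA).mul_const _
  have hsum := hA'.add hE0
  rw [add_zero] at hsum
  refine hsum.congr fun m => ?_
  have : ∫ w, ((k m w : ℝ) : ℂ) * (h w - h ζ) ∂μ =
      (∫ w, ((k m w : ℝ) : ℂ) * h w ∂μ) - ((Jf d σ s (zs m) : ℝ) : ℂ) * h ζ := by
    rw [← hJ m, ← integral_sub (hkh m) (hkc m)]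
    simp only [mul_sub]
  simp only [hE]
  rw [this]
  simp only [k, hzs]
  push_cast
  ring

noncomputable def Gx (d : ℕ) (s : ℝ) (z w : Cd d) : ℂ :=
  (1 - herm z w) ^ (s : ℂ) / ((‖1 - herm z w‖ ^ s : ℝ) : ℂ)

lemma Gx_meas (d : ℕ) (s : ℝ) (z : Cd d) : Measurable (Gx d s z) := by
  have h0 : Measurable (fun w => 1 - herm z w) := measurable_const.sub (measurable_herm z).measurable
  exact (h0.pow_const _).div (Complex.measurable_ofReal.comp (h0.norm.pow_const s))

lemma Gx_norm (d : ℕ) (s : ℝ) (z w : Cd d) : ‖Gx d s z w‖ ≤ 1 := by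
  rw [Gx, norm_div, Complex.norm_cpow_real, Complex.norm_real, Real.norm_of_nonneg (by positivity)]
  exact div_self_le_one _

lemma cont_Z (d n : ℕ) : Continuous (Zmap d n) := by
  refine continuous_pi fun α => ?_
  simp only [Zmap]
  fun_prop

lemma lim_D (d n : ℕ) (hd : 0 < d) (hn : 0 < n) (σ : ℝ) (hσ : -1 < σ) (ζ : Cd d) (hζ : ‖ζ‖ = 1)
    (r : ℕ → ℝ) (hr0 : ∀ m, 0 < r m) (hr1 : ∀ m, r m < 1) (hr : Tendsto r atTop (𝓝 1)) :
    Tendsto (fun m => (((1 - r m ^ 2) ^ n : ℝ) : ℂ) •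
        Dmap d n (bergman d σ (Gx d (d + 1 + σ + n) ((r m : ℂ) • ζ))) ((r m : ℂ) • ζ)) atTop
      (𝓝 (((Real.Gamma (d + 1 + σ + n) * Real.Gamma n / Real.Gamma ((d + 1 + σ + n) / 2) ^ 2 : ℝ) : ℂ) •
        fun α => (starRingEnd ℂ) (Zmap d n ζ α))) := by
  rw [tendsto_pi_nhds]
  intro α
  have hzb : ∀ m, ((r m : ℂ) • ζ) ∈ unitBall d := by
    intro m
    simp only [unitBall, Metric.mem_ball, dist_zero_right]
    rw [norm_smul, hζ, Complex.norm_real, Real.norm_of_nonneg (hr0 m).le, mul_one]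
    exact hr1 m
  have hcont : Continuous fun w : Cd d => (starRingEnd ℂ) (Zmap d n w α) :=
    Complex.continuous_conj.comp ((continuous_apply α).comp (cont_Z d n))
  have h1 := (conc d n hd hn σ hσ ζ hζ r hr0 hr1 hr _ hcont
    (fun w hw => by rw [RCLike.norm_conj]; exact norm_Z_le d n w hw α)).const_mul
    ((Real.Gamma (d + 1 + σ + n) / (Real.Gamma (σ + 1) * Real.Gamma (d + 1)) : ℝ) : ℂ)
  have g2 := Real.Gamma_pos_of_pos (show 0 < σ + 1 by linarith)
  have g3 := Real.Gamma_pos_of_pos (show (0:ℝ) < d + 1 by positivity)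
  convert h1 using 1
  · ext m
    rw [Pi.smul_apply, smul_eq_mul, Dmap_eq d n hd σ hσ _ (Gx_meas _ _ _) (Gx_norm _ _ _) _ (hzb m) α, If,
      mul_left_comm]
    congr 2
    refine setIntegral_congr_fun (measurableSet_unitBall d) fun w hw => ?_
    have hz := hzb m
    have hz' : ‖(r m : ℂ) • ζ‖ < 1 := by simpa [unitBall] using hz
    have hne := Complex.slitPlane_ne_zero (re_pos le_rfl hz' hw).2
    have hne2 : (1 - herm ((r m : ℂ) • ζ) w) ^ ((((d:ℝ) + 1 + σ + n : ℝ)) : ℂ) ≠ 0 := by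
      rw [Complex.cpow_def_of_ne_zero hne]; exact Complex.exp_ne_zero _
    simp only [Gx]
    rw [Complex.ofReal_mul, Complex.ofReal_inv]
    generalize (1 - herm ((r m : ℂ) • ζ) w) ^ ((((d:ℝ) + 1 + σ + n : ℝ)) : ℂ) = X at hne2
    rw [div_eq_iff hne2]
    ring
  · rw [Pi.smul_apply, smul_eq_mul, ← mul_assoc, ← Complex.ofReal_mul]
    congr 4
    field_simp

theorem main
    (d n : ℕ) (hd : 0 < d) (hn : 0 < n) (σ : ℝ) (hσ : -1 < σ)
    (N : (MIdx d n → ℂ) → ℝ)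
    (hN_nonneg : ∀ x, 0 ≤ N x)
    (hN_add : ∀ x y, N (x + y) ≤ N x + N y)
    (hN_smul : ∀ (c : ℂ) (x), N (c • x) = ‖c‖ * N x)
    (hN_conj : ∀ x, N (fun i => (starRingEnd ℂ) (x i)) = N x) :
    ∃ (zs : ℕ → Cd d) (Gs : ℕ → Cd d → ℂ) (ℓ : ℝ),
        (∀ m, zs m ∈ unitBall d) ∧ (∀ m, Measurable (Gs m)) ∧ (∀ m w, ‖Gs m w‖ ≤ 1) ∧
        maxC d n N * (Real.Gamma (d + 1 + σ + n) * Real.Gamma n / Real.Gamma ((d + 1 + σ + n) / 2) ^ 2) ≤ ℓ ∧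
        Tendsto (fun m => (1 - ‖zs m‖ ^ 2) ^ n * N (Dmap d n (bergman d σ (Gs m)) (zs m))) atTop (𝓝 ℓ) := by
  have hNc := N_cont N hN_add hN_smul
  have hcpt : IsCompact (Metric.sphere (0 : Cd d) 1) := isCompact_sphere 0 1
  have hne : (Metric.sphere (0 : Cd d) 1).Nonempty :=
    ⟨EuclideanSpace.single ⟨0, hd⟩ 1, by simp⟩
  obtain ⟨ζ, hζs, hmax⟩ := hcpt.exists_isMaxOn hne (hNc.comp (cont_Z d n)).continuousOn
  have hζ : ‖ζ‖ = 1 := by simpa using hζs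
  let r : ℕ → ℝ := fun m => 1 - 1 / ((m:ℝ) + 2)
  have hr0 : ∀ m, 0 < r m := by
    intro m
    simp only [r]
    rw [sub_pos, div_lt_one (by positivity)]
    have : (0:ℝ) ≤ m := by positivity
    linarith
  have hr1 : ∀ m, r m < 1 := by
    intro m
    have : 0 < 1 / ((m:ℝ) + 2) := by positivity
    simp only [r]; linarith
  have hr : Tendsto r atTop (𝓝 1) := by
    have h1 : Tendsto (fun m : ℕ => (m:ℝ) + 2) atTop atTop :=
      tendsto_atTop_add_const_right _ _ tendsto_natCast_atTop_atTop
    have := (h1.inv_tendsto_atTop).const_sub (1:ℝ)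
    simpa [r] using this
  have hnz : ∀ m, ‖(r m : ℂ) • ζ‖ = r m := by
    intro m
    rw [norm_smul, hζ, Complex.norm_real, Real.norm_of_nonneg (hr0 m).le, mul_one]
  have hrp : ∀ m, 0 ≤ (1 - r m ^ 2) ^ n := fun m =>
    pow_nonneg (by nlinarith [hr0 m, hr1 m]) n
  have hl := (hNc.tendsto _).comp (lim_D d n hd hn σ hσ ζ hζ r hr0 hr1 hr)
  have hL : 0 ≤ Real.Gamma (d + 1 + σ + n) * Real.Gamma n / Real.Gamma ((d + 1 + σ + n) / 2) ^ 2 := by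
    have hn' : (0:ℝ) < n := by exact_mod_cast hn
    have hd' : (0:ℝ) ≤ d := by positivity
    have g1 := Real.Gamma_pos_of_pos hn'
    have g2 := Real.Gamma_pos_of_pos (show 0 < (d:ℝ) + 1 + σ + n by linarith)
    positivity
  rw [hN_smul, hN_conj, Complex.norm_real, Real.norm_of_nonneg hL] at hl
  refine ⟨fun m => (r m : ℂ) • ζ, fun m => Gx d (d + 1 + σ + n) ((r m : ℂ) • ζ), _, ?_,
    fun m => Gx_meas _ _ _, fun m => Gx_norm _ _ _, ?_, hl.congr fun m => ?_⟩
  · intro m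
    simp only [unitBall, Metric.mem_ball, dist_zero_right, hnz]
    exact hr1 m
  · rw [mul_comm]
    refine mul_le_mul_of_nonneg_left ?_ hL
    have : Nonempty (Metric.sphere (0 : Cd d) 1) := hne.to_subtype
    exact ciSup_le fun x => hmax x.2
  · simp only [Function.comp, hN_smul, hnz]
    rw [Complex.norm_real, Real.norm_of_nonneg (hrp m)]

lemma bdd (d n : ℕ) (hd : 0 < d) (hn : 0 < n) (σ : ℝ) (hσ : -1 < σ)
    (N : (MIdx d n → ℂ) → ℝ)
    (hN_nonneg : ∀ x, 0 ≤ N x)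
    (hN_add : ∀ x y, N (x + y) ≤ N x + N y)
    (hN_smul : ∀ (c : ℂ) (x), N (c • x) = ‖c‖ * N x) :
    ∃ B, ∀ G : Cd d → ℂ, Measurable G → (∀ w, ‖G w‖ ≤ 1) → ∀ z ∈ unitBall d,
      (1 - ‖z‖ ^ 2) ^ n * N (Dmap d n (bergman d σ G) z) ≤ B := by
  obtain ⟨⟨M, hM⟩, -⟩ := J_asymp d n hd hn σ hσ
  obtain ⟨K, hK⟩ := N_le N hN_add hN_smul
  set C := Real.Gamma (d + 1 + σ + n) / (Real.Gamma (σ + 1) * Real.Gamma (d + 1)) with hC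
  have hC0 : 0 ≤ C := by
    have hn' : (0:ℝ) < n := by exact_mod_cast hn
    have hd' : (0:ℝ) ≤ d := by positivity
    have h1 := Real.Gamma_pos_of_pos (show 0 < (d:ℝ) + 1 + σ + n by linarith)
    have h2 := Real.Gamma_pos_of_pos (show 0 < σ + 1 by linarith)
    have h3 := Real.Gamma_pos_of_pos (show (0:ℝ) < d + 1 by positivity)
    positivity
  refine ⟨∑ i, C * M * |K i|, fun G hG hG1 z hz => ?_⟩
  have hz' : ‖z‖ < 1 := by simpa [unitBall] using hz
  have hp : 0 ≤ (1 - ‖z‖ ^ 2) ^ n := pow_nonneg (by nlinarith [norm_nonneg z]) n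
  refine (mul_le_mul_of_nonneg_left (hK _) hp).trans ?_
  rw [Finset.mul_sum]
  refine Finset.sum_le_sum fun α _ => ?_
  have h1 := norm_Dmap_le d n hd σ hσ G hG hG1 z hz α
  have h2 := hM z hz
  calc (1 - ‖z‖ ^ 2) ^ n * (‖Dmap d n (bergman d σ G) z α‖ * K α)
      ≤ (1 - ‖z‖ ^ 2) ^ n * (‖Dmap d n (bergman d σ G) z α‖ * |K α|) := by
        gcongr; exact le_abs_self _
    _ ≤ (1 - ‖z‖ ^ 2) ^ n * ((C * Jf d σ (d + 1 + σ + n) z) * |K α|) := by gcongr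
    _ = C * ((1 - ‖z‖ ^ 2) ^ n * Jf d σ (d + 1 + σ + n) z) * |K α| := by ring
    _ ≤ _ := by gcongr

lemma le_opSemi (d n : ℕ) (hd : 0 < d) (hn : 0 < n) (σ : ℝ) (hσ : -1 < σ)
    (N : (MIdx d n → ℂ) → ℝ)
    (hN_nonneg : ∀ x, 0 ≤ N x)
    (hN_add : ∀ x y, N (x + y) ≤ N x + N y)
    (hN_smul : ∀ (c : ℂ) (x), N (c • x) = ‖c‖ * N x)
    (G : Cd d → ℂ) (hG : Measurable G) (hG1 : ∀ w, ‖G w‖ ≤ 1) (z : Cd d) (hz : z ∈ unitBall d) :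
    (1 - ‖z‖ ^ 2) ^ n * N (Dmap d n (bergman d σ G) z) ≤ opSemi d n σ N := by
  obtain ⟨B, hB⟩ := bdd d n hd hn σ hσ N hN_nonneg hN_add hN_smul
  have hne : Nonempty (unitBall d) := ⟨⟨z, hz⟩⟩
  have h1 : (1 - ‖z‖ ^ 2) ^ n * N (Dmap d n (bergman d σ G) z) ≤ blochSemi d n N (bergman d σ G) := by
    refine le_ciSup (f := fun z : unitBall d => (1 - ‖(z : Cd d)‖ ^ 2) ^ n * N (Dmap d n (bergman d σ G) z)) ?_ ⟨z, hz⟩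
    refine ⟨B, ?_⟩
    rintro _ ⟨x, rfl⟩
    exact hB G hG hG1 x x.2
  refine h1.trans ?_
  refine le_ciSup (f := fun G : {G : Cd d → ℂ // Measurable G ∧ ∀ w, ‖G w‖ ≤ 1} =>
    blochSemi d n N (bergman d σ G.1)) ?_ ⟨G, hG, hG1⟩
  refine ⟨B, ?_⟩
  rintro _ ⟨x, rfl⟩
  exact ciSup_le fun y => hB x.1 x.2.1 x.2.2 y y.2

end BPS

/-- Lower bound: there are points `z_m ∈ B` and measurable functions `G_m` with `‖G_m‖_∞ ≤ 1`
such that `liminf_m (1-|z_m|²)^n |𝒟_z (T_σ G_m)(z_m)| ≥ 𝓒 · Γ(λ+n)Γ(n)/Γ((λ+n)/2)²`;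
consequently the operator seminorm is at least this quantity. -/
theorem bergman_projection_seminorm_lower
    (d n : ℕ) (hd : 0 < d) (hn : 0 < n) (σ : ℝ) (hσ : -1 < σ)
    (lam : ℝ) (hlam : lam = d + 1 + σ)
    (N : (MIdx d n → ℂ) → ℝ)
    (hN_nonneg : ∀ x, 0 ≤ N x)
    (hN_def : ∀ x, N x = 0 → x = 0)
    (hN_add : ∀ x y, N (x + y) ≤ N x + N y)
    (hN_smul : ∀ (c : ℂ) (x), N (c • x) = ‖c‖ * N x)
    (hN_conj : ∀ x, N (fun i => (starRingEnd ℂ) (x i)) = N x) :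
    (∃ (zs : ℕ → Cd d) (Gs : ℕ → Cd d → ℂ),
        (∀ m, zs m ∈ unitBall d) ∧ (∀ m, Measurable (Gs m)) ∧ (∀ m w, ‖Gs m w‖ ≤ 1) ∧
        maxC d n N * (Real.Gamma (lam + n) * Real.Gamma n / Real.Gamma ((lam + n) / 2) ^ 2) ≤
          Filter.liminf
            (fun m => (1 - ‖zs m‖ ^ 2) ^ n * N (Dmap d n (bergman d σ (Gs m)) (zs m)))
            Filter.atTop) ∧
    maxC d n N * (Real.Gamma (lam + n) * Real.Gamma n / Real.Gamma ((lam + n) / 2) ^ 2) ≤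
      opSemi d n σ N := by
  subst hlam
  obtain ⟨zs, Gs, ℓ, h1, h2, h3, h4, h5⟩ := BPS.main d n hd hn σ hσ N hN_nonneg hN_add hN_smul hN_conj
  refine ⟨⟨zs, Gs, h1, h2, h3, ?_⟩, ?_⟩
  · rw [h5.liminf_eq]; exact h4
  · exact h4.trans (le_of_tendsto' h5 fun m =>
      BPS.le_opSemi d n hd hn σ hσ N hN_nonneg hN_add hN_smul _ (h2 m) (h3 m) _ (h1 m))
end

section
/- Let d = 1, let U be the open unit disc in ℂ, let n be a positive integer, σ > -1, and let |·|_ℂ be any norm on ℂ with |conj(z)|_ℂ = |z|_ℂ. With the Bloch seminorm ‖f‖_𝓑 = sup_{z∈U} (1-|z|²)^n |f^{(n)}(z)|_ℂ, the Bergman projection T_σ : L^∞(U) → 𝓑 satisfies ‖T_σ‖_{L^∞(U) → 𝓑} = 𝓒 · Γ(2+σ+n)Γ(n) / Γ(1+(σ+n)/2)², where 𝓒 = max_{|ζ|=1} |ζ|_ℂ. -/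
open MeasureTheory Complex
open scoped ENNReal

noncomputable section

/-- The open unit disc in `ℂ`. -/
def unitDisc : Set ℂ := Metric.ball 0 1

/-- Lebesgue measure on `ℂ`, normalized so that the unit disc has measure one. -/
def normVolD : Measure ℂ := (volume unitDisc)⁻¹ • volume

/-- The Bergman projection on the unit disc,
`T_σ f(z) = c_σ ∫_U (1-|w|²)^σ/(1-z conj w)^{2+σ} f(w) dv(w)` with `c_σ = Γ(2+σ)/Γ(σ+1)`. -/
def bergmanD (σ : ℝ) (f : ℂ → ℂ) (z : ℂ) : ℂ :=
  ((Real.Gamma (2 + σ) / Real.Gamma (σ + 1) : ℝ) : ℂ) *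
    ∫ w in unitDisc,
      (((1 - ‖w‖ ^ 2 : ℝ) ^ σ : ℝ) : ℂ) / (1 - z * (starRingEnd ℂ) w) ^ ((2 + σ : ℝ) : ℂ) * f w
      ∂normVolD

/-- Rising factorial. -/
def poch (s : ℝ) (k : ℕ) : ℝ := ∏ j ∈ Finset.range k, (s + j)

lemma poch_pos {s : ℝ} (hs : 0 < s) (k : ℕ) : 0 < poch s k :=
  Finset.prod_pos fun j _ => by positivity

lemma poch_succ (s : ℝ) (k : ℕ) : poch s (k + 1) = poch s k * (s + k) :=
  Finset.prod_range_succ _ _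

lemma beta_real (σ : ℝ) (hσ : -1 < σ) (k : ℕ) :
    ∫ x in Set.Ioo (0 : ℝ) 1, x ^ σ * (1 - x) ^ k = (k.factorial : ℝ) / poch (σ + 1) (k + 1) := by
  have h := Complex.betaIntegral_eval_nat_add_one_right (u := ((σ + 1 : ℝ) : ℂ))
    (by simp; linarith) k
  rw [Complex.betaIntegral, intervalIntegral.integral_of_le zero_le_one,
    integral_Ioc_eq_integral_Ioo] at h
  have h2 : ∫ x in Set.Ioo (0 : ℝ) 1, (x : ℂ) ^ (((σ + 1 : ℝ) : ℂ) - 1) *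
      (1 - (x : ℂ)) ^ ((k : ℂ) + 1 - 1) =
      ∫ x in Set.Ioo (0 : ℝ) 1, ((x ^ σ * (1 - x) ^ k : ℝ) : ℂ) := by
    refine setIntegral_congr_fun measurableSet_Ioo fun x hx => ?_
    simp only [ofReal_add, ofReal_one, add_sub_cancel_right, ofReal_mul, ofReal_pow, ofReal_sub]
    rw [Complex.ofReal_cpow hx.1.le, Complex.cpow_natCast]
  rw [h2, integral_complex_ofReal] at h
  have h3 : ((k.factorial : ℂ) / ∏ j ∈ Finset.range (k + 1), (((σ + 1 : ℝ) : ℂ) + j)) =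
      (((k.factorial : ℝ) / poch (σ + 1) (k + 1) : ℝ) : ℂ) := by
    simp [poch]
  rw [h3] at h
  exact_mod_cast h

lemma image_sq : (fun r : ℝ => 1 - r ^ 2) '' Set.Ioo 0 1 = Set.Ioo 0 1 := by
  ext x
  constructor
  · rintro ⟨r, ⟨h0, h1⟩, rfl⟩
    constructor <;> dsimp only <;> nlinarith
  · rintro ⟨h0, h1⟩
    refine ⟨Real.sqrt (1 - x), ⟨Real.sqrt_pos.2 (by linarith), ?_⟩, ?_⟩
    · rw [Real.sqrt_lt' one_pos]; linarith
    · dsimp only; rw [Real.sq_sqrt (by linarith)]; ring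

lemma radial (σ : ℝ) (hσ : -1 < σ) (k : ℕ) :
    ∫ r in Set.Ioo (0 : ℝ) 1, r * ((1 - r ^ 2) ^ σ * (r ^ 2) ^ k) =
      (k.factorial : ℝ) / poch (σ + 1) (k + 1) / 2 := by
  have h := integral_image_eq_integral_abs_deriv_smul (s := Set.Ioo (0 : ℝ) 1)
    (f := fun r : ℝ => 1 - r ^ 2) (f' := fun r => - (2 * r)) measurableSet_Ioo
    (fun x _ => by
      have := ((hasDerivAt_pow 2 x).const_sub 1).hasDerivWithinAt (s := Set.Ioo (0 : ℝ) 1)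
      simpa using this)
    (fun x hx y hy hxy => by
      have : x ^ 2 = y ^ 2 := by simpa using hxy
      exact (pow_left_inj₀ hx.1.le hy.1.le two_ne_zero).1 this)
    (fun x => x ^ σ * (1 - x) ^ k)
  rw [image_sq, beta_real σ hσ k] at h
  rw [h, eq_div_iff two_ne_zero, ← integral_mul_const]
  refine setIntegral_congr_fun measurableSet_Ioo fun x hx => ?_
  have := hx.1
  simp only [abs_neg, smul_eq_mul, sub_sub_cancel]
  rw [abs_of_pos (by positivity)]
  ring

/-- normalized measure restricted to the disc -/
def muD : Measure ℂ := normVolD.restrict unitDisc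

lemma vol_pos : volume unitDisc ≠ 0 := (Metric.measure_ball_pos volume (0 : ℂ) one_pos).ne'
lemma vol_fin : volume unitDisc ≠ ⊤ := measure_ball_lt_top.ne

lemma meas_disc : MeasurableSet unitDisc := measurableSet_ball

lemma moment (σ : ℝ) (hσ : -1 < σ) (k : ℕ) :
    ∫ w, (1 - ‖w‖ ^ 2) ^ σ * (‖w‖ ^ 2) ^ k ∂muD =
      (k.factorial : ℝ) / poch (σ + 1) (k + 1) := by
  have h := integral_fun_norm_addHaar (volume : Measure ℂ)
    ((Set.Iio (1 : ℝ)).indicator fun r => (1 - r ^ 2) ^ σ * (r ^ 2) ^ k)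
  rw [muD, normVolD, Measure.restrict_smul, integral_smul_measure, ← integral_indicator meas_disc]
  have e1 : (unitDisc.indicator fun w : ℂ => (1 - ‖w‖ ^ 2) ^ σ * (‖w‖ ^ 2) ^ k) =
      fun w : ℂ => (Set.Iio (1 : ℝ)).indicator (fun r => (1 - r ^ 2) ^ σ * (r ^ 2) ^ k) ‖w‖ := by
    ext w
    by_cases hw : ‖w‖ < 1
    · rw [Set.indicator_of_mem (by simpa [unitDisc] using hw), Set.indicator_of_mem (Set.mem_Iio.2 hw)]
    · rw [Set.indicator_of_notMem (by simpa [unitDisc] using hw), Set.indicator_of_notMem (by simpa using hw)]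
  rw [e1, h]
  have e2 : ∫ y in Set.Ioi (0 : ℝ), y ^ (Module.finrank ℝ ℂ - 1) •
      (Set.Iio (1 : ℝ)).indicator (fun r => (1 - r ^ 2) ^ σ * (r ^ 2) ^ k) y =
      ∫ r in Set.Ioo (0 : ℝ) 1, r * ((1 - r ^ 2) ^ σ * (r ^ 2) ^ k) := by
    rw [← Set.Ioi_inter_Iio, ← setIntegral_indicator measurableSet_Iio]
    congr 1
    ext y
    by_cases hy : y < 1
    · rw [Set.indicator_of_mem (Set.mem_Iio.2 hy), Set.indicator_of_mem (Set.mem_Iio.2 hy)]; simp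
    · rw [Set.indicator_of_notMem (by simpa using hy), Set.indicator_of_notMem (by simpa using hy)]
      simp
  rw [e2, radial σ hσ k]
  have h1 := vol_pos
  have h2 := vol_fin
  have h3 : (volume unitDisc).toReal ≠ 0 := ENNReal.toReal_ne_zero.2 ⟨h1, h2⟩
  have h4 : (volume : Measure ℂ).real (Metric.ball 0 1) = (volume unitDisc).toReal := rfl
  rw [h4]
  simp only [ENNReal.toReal_inv, Complex.finrank_real_complex, smul_eq_mul, nsmul_eq_mul]
  field_simp
  simp

lemma integrable_weight (σ : ℝ) (hσ : -1 < σ) (k : ℕ) :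
    Integrable (fun w : ℂ => (1 - ‖w‖ ^ 2) ^ σ * (‖w‖ ^ 2) ^ k) muD := by
  apply Integrable.of_integral_ne_zero
  rw [moment σ hσ k]
  have := poch_pos (s := σ + 1) (by linarith) (k + 1)
  positivity
lemma rot_mp (c : Circle) : MeasurePreserving (rotation c) muD muD := by
  have h : MeasurePreserving (rotation c) normVolD normVolD :=
    (rotation c).measurePreserving.smul_measure _
  have h2 := h.restrict_preimage meas_disc
  have h3 : (rotation c) ⁻¹' unitDisc = unitDisc := by
    ext w; simp only [unitDisc, Set.mem_preimage, mem_ball_zero_iff, LinearIsometryEquiv.norm_map]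
  rwa [h3] at h2

lemma orth (φ : ℝ → ℝ) (a b : ℕ) (hab : a ≠ b) :
    ∫ w, (φ ‖w‖ : ℂ) * (w ^ a * (starRingEnd ℂ) w ^ b) ∂muD = 0 := by
  set α : ℝ := Real.pi / ((a : ℝ) - b) with hα
  have hne : (a : ℝ) - b ≠ 0 := sub_ne_zero.2 (by exact_mod_cast hab)
  have h := (rot_mp (Circle.exp α)).integral_comp
    (rotation (Circle.exp α)).toHomeomorph.measurableEmbedding
    (fun w : ℂ => (φ ‖w‖ : ℂ) * (w ^ a * (starRingEnd ℂ) w ^ b))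
  have e : ∀ w : ℂ, (φ ‖rotation (Circle.exp α) w‖ : ℂ) * ((rotation (Circle.exp α) w) ^ a *
      (starRingEnd ℂ) (rotation (Circle.exp α) w) ^ b) =
      - ((φ ‖w‖ : ℂ) * (w ^ a * (starRingEnd ℂ) w ^ b)) := by
    intro w
    have k : cexp (α * I) ^ a * cexp (-(α * I)) ^ b = -1 := by
      rw [← Complex.exp_nat_mul, ← Complex.exp_nat_mul, ← Complex.exp_add, ← Complex.exp_pi_mul_I]
      congr 1
      have : (Real.pi : ℂ) = α * ((a : ℂ) - b) := by
        have : Real.pi = α * ((a : ℝ) - b) := by rw [hα]; field_simp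
        exact_mod_cast congrArg (fun x : ℝ => (x : ℂ)) this
      rw [this]; ring
    have k2 : (starRingEnd ℂ) (cexp (α * I)) = cexp (-(α * I)) := by
      rw [← Complex.exp_conj]; simp
    rw [LinearIsometryEquiv.norm_map]
    simp only [rotation_apply, Circle.coe_exp, map_mul, k2, mul_pow]
    linear_combination (φ ‖w‖ : ℂ) * (w ^ a * (starRingEnd ℂ) w ^ b) * k
  simp only [e] at h
  rw [integral_neg] at h
  have : (2 : ℂ) * ∫ w, (φ ‖w‖ : ℂ) * (w ^ a * (starRingEnd ℂ) w ^ b) ∂muD = 0 := by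
    linear_combination -h
  simpa using this

/-- Taylor coefficients of `(1-x)^{-l}` -/
def bc (l : ℝ) (k : ℕ) : ℝ := poch l k / k.factorial

lemma choose_eq (l : ℝ) (k : ℕ) : Ring.choose ((l : ℂ) + k - 1) k = (bc l k : ℂ) := by
  have h1 : Ring.choose ((l : ℂ) + k - 1) k = Ring.multichoose (l : ℂ) k := by
    rw [Ring.choose]; congr 1; ring
  have h := Ring.factorial_nsmul_multichoose_eq_ascPochhammer (l : ℂ) k
  rw [← h1] at h
  have h2 : (ascPochhammer ℕ k).smeval (l : ℂ) = (poch l k : ℂ) := by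
    rw [Polynomial.ascPochhammer_smeval_eq_eval]
    induction k with
    | zero => simp [poch]
    | succ k ih => 
      rw [ascPochhammer_succ_eval, poch_succ, ih]
      · simp
      · rw [Ring.choose]; congr 1; ring
      · exact Ring.factorial_nsmul_multichoose_eq_ascPochhammer (l : ℂ) k ▸ by
          rw [Ring.choose]; congr 2; ring
  rw [h2] at h
  have h3 : (k.factorial : ℂ) ≠ 0 := by exact_mod_cast k.factorial_ne_zero
  rw [bc, ofReal_div, ← h, nsmul_eq_mul]
  simp only [ofReal_natCast]
  field_simp

lemma series (l : ℝ) (x : ℂ) (hx : ‖x‖ < 1) :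
    HasSum (fun k => (bc l k : ℂ) * x ^ k) (1 / (1 - x) ^ (l : ℂ)) := by
  have h := (Complex.one_div_one_sub_cpow_hasFPowerSeriesOnBall_zero (l : ℂ)).hasSum
    (y := x) (by
      rw [Metric.mem_eball, edist_zero_right, ← ofReal_norm]
      exact ENNReal.ofReal_lt_one.2 hx)
  simpa [FormalMultilinearSeries.ofScalars, choose_eq] using h

lemma bc_nonneg {l : ℝ} (hl : 0 < l) (k : ℕ) : 0 ≤ bc l k :=
  div_nonneg (poch_pos hl k).le (by positivity)

lemma series_summable (l : ℝ) (r : ℝ) (h0 : 0 ≤ r) (hr : r < 1) :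
    Summable (fun k => bc l k * r ^ k) := by
  have h := (series l (r : ℂ) (by simpa [abs_of_nonneg h0] using hr)).summable
  have : (fun k => (bc l k : ℂ) * (r : ℂ) ^ k) = fun k => ((bc l k * r ^ k : ℝ) : ℂ) := by
    ext k; simp
  rw [this] at h
  exact_mod_cast h

lemma ae_disc : ∀ᵐ w ∂muD, ‖w‖ < 1 := by
  have := ae_restrict_mem (μ := normVolD) meas_disc
  filter_upwards [this] with w hw
  simpa [unitDisc] using hw

lemma norm_kernel (s : ℝ) (x : ℂ) : ‖1 / (1 - x) ^ (s : ℂ)‖ = 1 / ‖1 - x‖ ^ s := by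
  rw [norm_div, norm_one, Complex.norm_cpow_real]

lemma kernel_sq (l : ℝ) (x : ℂ) :
    (((1 / ‖1 - x‖ ^ (2 * l) : ℝ)) : ℂ) =
      1 / (1 - x) ^ (l : ℂ) * (starRingEnd ℂ) (1 / (1 - x) ^ (l : ℂ)) := by
  rw [Complex.mul_conj, Complex.normSq_eq_norm_sq, norm_kernel, div_pow, one_pow, mul_comm 2 l,
    Real.rpow_mul (norm_nonneg _)]
  simp

lemma parseval (l : ℝ) (hl : 0 < l) (φ : ℝ → ℝ) (hφ : Integrable (fun w : ℂ => φ ‖w‖) muD)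
    (z : ℂ) (hz : ‖z‖ < 1) :
    HasSum (fun k => bc l k ^ 2 * (‖z‖ ^ 2) ^ k * ∫ w, φ ‖w‖ * (‖w‖ ^ 2) ^ k ∂muD)
      (∫ w, φ ‖w‖ * (1 / ‖1 - z * (starRingEnd ℂ) w‖ ^ (2 * l)) ∂muD) := by
  set F : ℕ × ℕ → ℂ → ℂ := fun p w => (φ ‖w‖ : ℂ) *
    (((bc l p.1 : ℂ) * (z * (starRingEnd ℂ) w) ^ p.1) *
      ((bc l p.2 : ℂ) * ((starRingEnd ℂ) z * w) ^ p.2)) with hF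
  have hs := series_summable l ‖z‖ (norm_nonneg _) hz
  have hbound : ∀ p, ∀ᵐ w ∂muD, ‖F p w‖ ≤
      |φ ‖w‖| * ((bc l p.1 * ‖z‖ ^ p.1) * (bc l p.2 * ‖z‖ ^ p.2)) := by
    intro p
    filter_upwards [ae_disc] with w hw
    have h1 : ∀ k, ‖w‖ ^ k ≤ 1 := fun k => pow_le_one₀ (norm_nonneg _) hw.le
    have hb := fun k => bc_nonneg hl k
    simp only [hF, norm_mul, norm_pow, RCLike.norm_conj, norm_real, Real.norm_eq_abs,
      abs_of_nonneg (hb _), mul_pow]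
    gcongr
    · have := hb p.2; positivity
    · have := hb p.1; positivity
    · exact hb _
    · exact mul_le_of_le_one_right (by positivity) (h1 _)
    · exact hb _
    · exact mul_le_of_le_one_right (by positivity) (h1 _)
  have hint : ∀ p, Integrable (F p) muD := by
    intro p
    refine Integrable.mono' (hφ.abs.mul_const _) ?_ (hbound p)
    refine AEStronglyMeasurable.mul ?_ ?_
    · exact Complex.continuous_ofReal.comp_aestronglyMeasurable hφ.1
    · exact Continuous.aestronglyMeasurable (by fun_prop)
  have hsum : Summable fun p => ∫ w, ‖F p w‖ ∂muD := by
    have hs2 := (hs.mul_of_nonneg hs (fun k => by have := bc_nonneg hl k; positivity)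
      (fun k => by have := bc_nonneg hl k; positivity)).mul_left (∫ w, |φ ‖w‖| ∂muD)
    refine Summable.of_nonneg_of_le (fun p => integral_nonneg fun w => norm_nonneg _) ?_ hs2
    intro p
    rw [← integral_mul_const]
    exact integral_mono_ae (hint p).norm (hφ.abs.mul_const _) (hbound p)
  have hmain := hasSum_integral_of_summable_integral_norm hint hsum
  have htsum : ∫ w, ∑' p, F p w ∂muD =
      ((∫ w, φ ‖w‖ * (1 / ‖1 - z * (starRingEnd ℂ) w‖ ^ (2 * l)) ∂muD : ℝ) : ℂ) := by
    rw [← integral_complex_ofReal]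
    refine integral_congr_ae ?_
    filter_upwards [ae_disc] with w hw
    have hx : ‖z * (starRingEnd ℂ) w‖ < 1 := by
      rw [norm_mul, RCLike.norm_conj]
      nlinarith [norm_nonneg z, norm_nonneg w]
    have S := series l _ hx
    have S2 : HasSum (fun k => (bc l k : ℂ) * ((starRingEnd ℂ) z * w) ^ k)
        ((starRingEnd ℂ) (1 / (1 - z * (starRingEnd ℂ) w) ^ (l : ℂ))) := by
      have := S.map (starRingEnd ℂ) Complex.continuous_conj
      convert! this using 2 with k
      simp
    have hn : ∀ x : ℂ, ‖x‖ < 1 → Summable fun k => ‖(bc l k : ℂ) * x ^ k‖ := by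
      intro x hx
      have := series_summable l ‖x‖ (norm_nonneg _) hx
      simpa [abs_of_nonneg (bc_nonneg hl _)] using this
    have P := tsum_mul_tsum_of_summable_norm (hn _ hx)
      (hn ((starRingEnd ℂ) z * w) (by simpa using hx))
    rw [S.tsum_eq, S2.tsum_eq, ← kernel_sq] at P
    simp only [hF]
    rw [tsum_mul_left, ← P]
    simp
  rw [htsum] at hmain
  have hdiag : HasSum (fun k : ℕ => ∫ w, F (k, k) w ∂muD)
      ((∫ w, φ ‖w‖ * (1 / ‖1 - z * (starRingEnd ℂ) w‖ ^ (2 * l)) ∂muD : ℝ) : ℂ) := by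
    have hinj : Function.Injective (fun k : ℕ => (k, k)) := fun a b h => (Prod.mk.inj h).1
    refine (hinj.hasSum_iff ?_).2 hmain
    rintro ⟨a, b⟩ hab
    have hne : b ≠ a := by
      rintro rfl; exact hab ⟨b, rfl⟩
    have : F (a, b) = fun w => ((bc l a : ℂ) * (bc l b : ℂ) * z ^ a * (starRingEnd ℂ) z ^ b) *
        ((φ ‖w‖ : ℂ) * (w ^ b * (starRingEnd ℂ) w ^ a)) := by
      ext w; simp only [hF, mul_pow]; ring
    rw [this, integral_const_mul, orth φ b a hne, mul_zero]
  rw [← Complex.hasSum_ofReal]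
  convert hdiag using 2 with k
  rw [ofReal_mul, ← integral_complex_ofReal, ← integral_const_mul]
  congr 1
  ext w
  simp only [hF, mul_pow, ofReal_mul, ofReal_pow, ← pow_mul]
  have e1 := Complex.mul_conj' z
  have e2 := Complex.mul_conj' w
  simp only [pow_mul, ← e1, ← e2, mul_pow]
  ring

lemma one_sub_re_pos {x : ℂ} (hx : ‖x‖ < 1) : 1 - x ∈ slitPlane := by
  left
  have := Complex.re_le_norm x
  simp; linarith

lemma kernel_deriv (s : ℝ) (a z : ℂ) (h : ‖z * a‖ < 1) :
    HasDerivAt (fun z : ℂ => 1 / (1 - z * a) ^ (s : ℂ))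
      (s * a / (1 - z * a) ^ ((s + 1 : ℝ) : ℂ)) z := by
  have h0 := one_sub_re_pos h
  have h1 : HasDerivAt (fun z : ℂ => 1 - z * a) (-a) z := by
    simpa using ((hasDerivAt_id z).mul_const a).const_sub 1
  have h2 := h1.cpow_const (c := -(s : ℂ)) h0
  have e : (fun z : ℂ => 1 / (1 - z * a) ^ (s : ℂ)) = fun z => (1 - z * a) ^ (-(s : ℂ)) := by
    ext z; rw [Complex.cpow_neg, one_div]
  rw [e]
  convert h2 using 1
  have : -(s : ℂ) - 1 = -((s + 1 : ℝ) : ℂ) := by push_cast; ring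
  rw [this, Complex.cpow_neg]
  ring

lemma deriv_step (h : ℂ → ℂ) (hh : Integrable h muD) (s : ℝ) (hs : 0 < s) (j : ℕ)
    (z₀ : ℂ) (hz : ‖z₀‖ < 1) :
    HasDerivAt (fun z => ∫ w, h w * (starRingEnd ℂ) w ^ j *
        (1 / (1 - z * (starRingEnd ℂ) w) ^ (s : ℂ)) ∂muD)
      (s * ∫ w, h w * (starRingEnd ℂ) w ^ (j + 1) *
        (1 / (1 - z₀ * (starRingEnd ℂ) w) ^ ((s + 1 : ℝ) : ℂ)) ∂muD) z₀ := by
  set δ : ℝ := (1 - ‖z₀‖) / 2 with hδ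
  have hδ0 : 0 < δ := by rw [hδ]; linarith
  have hball : ∀ z ∈ Metric.ball z₀ δ, ‖z‖ ≤ 1 - δ := by
    intro z hz'
    have h1 : ‖z - z₀‖ < δ := by simpa [dist_eq_norm] using hz'
    have h2 := norm_le_norm_add_norm_sub z₀ z
    rw [norm_sub_rev] at h2
    have : ‖z‖ ≤ ‖z₀‖ + ‖z - z₀‖ := by
      have := norm_add_le z₀ (z - z₀); simpa using this
    linarith
  have hprod : ∀ z ∈ Metric.ball z₀ δ, ∀ w : ℂ, ‖w‖ < 1 →
      ‖z * (starRingEnd ℂ) w‖ ≤ 1 - δ := by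
    intro z hz' w hw
    rw [norm_mul, RCLike.norm_conj]
    nlinarith [hball z hz', norm_nonneg z, norm_nonneg w]
  have hlow : ∀ z ∈ Metric.ball z₀ δ, ∀ w : ℂ, ‖w‖ < 1 → ∀ t : ℝ, 0 < t →
      ‖1 / (1 - z * (starRingEnd ℂ) w) ^ (t : ℂ)‖ ≤ 1 / δ ^ t := by
    intro z hz' w hw t ht
    rw [norm_kernel]
    have h1 := norm_sub_norm_le (1 : ℂ) (z * (starRingEnd ℂ) w)
    have h2 := hprod z hz' w hw
    rw [norm_one] at h1
    have : δ ≤ ‖1 - z * (starRingEnd ℂ) w‖ := by linarith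
    gcongr
  have hmeas : ∀ (z : ℂ) (i : ℕ) (t : ℝ), AEStronglyMeasurable (fun w => h w *
      (starRingEnd ℂ) w ^ i * (1 / (1 - z * (starRingEnd ℂ) w) ^ (t : ℂ))) muD := by
    intro z i t
    refine (hh.1.mul ?_).mul ?_
    · exact Continuous.aestronglyMeasurable (by fun_prop)
    · exact Measurable.aestronglyMeasurable (by fun_prop)
  have hwp : ∀ (w : ℂ) (i : ℕ), ‖w‖ < 1 → ‖(starRingEnd ℂ) w ^ i‖ ≤ 1 := by
    intro w i hw
    rw [norm_pow, RCLike.norm_conj]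
    exact pow_le_one₀ (norm_nonneg _) hw.le
  have hbd : ∀ z ∈ Metric.ball z₀ δ, ∀ w : ℂ, ‖w‖ < 1 → ∀ t : ℝ, 0 < t → ∀ i : ℕ,
      ‖h w * (starRingEnd ℂ) w ^ i * (1 / (1 - z * (starRingEnd ℂ) w) ^ (t : ℂ))‖ ≤
        ‖h w‖ * (1 / δ ^ t) := by
    intro z hz' w hw t ht i
    rw [norm_mul, norm_mul]
    gcongr
    · exact mul_le_of_le_one_right (norm_nonneg _) (hwp w i hw)
    · exact hlow z hz' w hw t ht
  have key := hasDerivAt_integral_of_dominated_loc_of_deriv_le (μ := muD) (𝕜 := ℂ)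
    (F := fun z w => h w * (starRingEnd ℂ) w ^ j *
        (1 / (1 - z * (starRingEnd ℂ) w) ^ (s : ℂ)))
    (F' := fun z w => s * (h w * (starRingEnd ℂ) w ^ (j + 1) *
        (1 / (1 - z * (starRingEnd ℂ) w) ^ ((s + 1 : ℝ) : ℂ))))
    (x₀ := z₀) (s := Metric.ball z₀ δ) (bound := fun w => s * (‖h w‖ * (1 / δ ^ (s + 1))))
    (Metric.ball_mem_nhds _ hδ0) (Filter.Eventually.of_forall fun z => hmeas z j s)
    (Integrable.mono' (hh.norm.mul_const _) (hmeas z₀ j s) (by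
      filter_upwards [ae_disc] with w hw
      exact hbd z₀ (Metric.mem_ball_self hδ0) w hw s hs j))
    ((hmeas z₀ (j + 1) (s + 1)).const_mul _)
    (by
      filter_upwards [ae_disc] with w hw z hz'
      rw [norm_mul, norm_real, Real.norm_eq_abs, abs_of_pos hs]
      exact mul_le_mul_of_nonneg_left (hbd z hz' w hw (s + 1) (by linarith) (j + 1)) hs.le)
    ((hh.norm.mul_const _).const_mul _)
    (by
      filter_upwards [ae_disc] with w hw z hz'
      have := (kernel_deriv s ((starRingEnd ℂ) w) z (by
        have := hprod z hz' w hw; linarith)).const_mul (h w * (starRingEnd ℂ) w ^ j)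
      exact this.congr_deriv (by ring))
  have := key.2
  rwa [integral_const_mul] at this

lemma iter_deriv (h : ℂ → ℂ) (hh : Integrable h muD) (s : ℝ) (hs : 0 < s) (n : ℕ) :
    ∀ z : ℂ, ‖z‖ < 1 →
    iteratedDeriv n (fun z => ∫ w, h w * (1 / (1 - z * (starRingEnd ℂ) w) ^ (s : ℂ)) ∂muD) z =
      poch s n * ∫ w, h w * (starRingEnd ℂ) w ^ n *
        (1 / (1 - z * (starRingEnd ℂ) w) ^ ((s + n : ℝ) : ℂ)) ∂muD := by
  induction n with
  | zero => intro z hz; simp [poch]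
  | succ n ih =>
    intro z hz
    rw [iteratedDeriv_succ]
    have hev : iteratedDeriv n (fun z => ∫ w, h w *
        (1 / (1 - z * (starRingEnd ℂ) w) ^ (s : ℂ)) ∂muD) =ᶠ[nhds z] fun z =>
        poch s n * ∫ w, h w * (starRingEnd ℂ) w ^ n *
        (1 / (1 - z * (starRingEnd ℂ) w) ^ ((s + n : ℝ) : ℂ)) ∂muD := by
      filter_upwards [Metric.isOpen_ball.mem_nhds (x := z) (s := Metric.ball (0 : ℂ) 1)
        (by simpa using hz)] with y hy
      exact ih y (by simpa using hy)
    rw [hev.deriv_eq, ((deriv_step h hh (s + n) (by positivity) n z hz).const_mul _).deriv,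
      poch_succ]
    have : s + (n : ℝ) + 1 = s + ((n + 1 : ℕ) : ℝ) := by push_cast; ring
    rw [this]
    push_cast
    ring

open Filter Topology in
lemma poch_ratio_tendsto (l a b : ℝ) (hl : 0 < l) (ha : 0 < a) (hb : 0 < b) (h : 2 * l = a + b) :
    Tendsto (fun k => poch l k ^ 2 / (poch a k * poch b k)) atTop
      (𝓝 (Real.Gamma a * Real.Gamma b / Real.Gamma l ^ 2)) := by
  rw [← tendsto_add_atTop_iff_nat 1]
  have h1 := ((Real.GammaSeq_tendsto_Gamma a).mul (Real.GammaSeq_tendsto_Gamma b)).div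
    ((Real.GammaSeq_tendsto_Gamma l).pow 2) (pow_ne_zero 2 (Real.Gamma_pos_of_pos hl).ne')
  refine h1.congr' ?_
  filter_upwards [eventually_gt_atTop 0] with k hk
  have hk' : (0 : ℝ) < k := by exact_mod_cast hk
  have e : ∀ s, Real.GammaSeq s k = (k : ℝ) ^ s * k.factorial / poch s (k + 1) := fun s => rfl
  simp only [Pi.mul_apply, Pi.div_apply, Pi.pow_apply, e]
  have p1 := poch_pos hl (k + 1)
  have p2 := poch_pos ha (k + 1)
  have p3 := poch_pos hb (k + 1)
  have pf : (0 : ℝ) < k.factorial := by positivity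
  have k1 : (0 : ℝ) < (k : ℝ) ^ a := by positivity
  have k2 : (0 : ℝ) < (k : ℝ) ^ b := by positivity
  have k3 : (0 : ℝ) < (k : ℝ) ^ l := by positivity
  have ke : ((k : ℝ) ^ l) ^ 2 = (k : ℝ) ^ a * (k : ℝ) ^ b := by
    rw [← Real.rpow_add hk', ← h, mul_comm 2 l, Real.rpow_mul hk'.le]; simp
  rw [div_pow, mul_pow, ke]
  field_simp

lemma poch_ratio_mono (l a b : ℝ) (hl : 0 < l) (ha : 0 < a) (hb : 0 < b) (h : 2 * l = a + b) :
    Monotone (fun k => poch l k ^ 2 / (poch a k * poch b k)) := by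
  refine monotone_nat_of_le_succ fun k => ?_
  have p1 := poch_pos hl k
  have p2 := poch_pos ha k
  have p3 := poch_pos hb k
  rw [poch_succ, poch_succ, poch_succ]
  have hk : (0 : ℝ) ≤ k := by positivity
  rw [div_le_div_iff₀ (by positivity) (by positivity)]
  have : (a + k) * (b + k) ≤ (l + k) ^ 2 := by
    have : l = (a + b) / 2 := by linarith
    rw [this]; nlinarith [sq_nonneg (a - b)]
  calc poch l k ^ 2 * (poch a k * (a + k) * (poch b k * (b + k)))
      = poch l k ^ 2 * (poch a k * poch b k) * ((a + k) * (b + k)) := by ring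
    _ ≤ poch l k ^ 2 * (poch a k * poch b k) * (l + k) ^ 2 := by gcongr
    _ = _ := by ring

lemma poch_ratio_le (l a b : ℝ) (hl : 0 < l) (ha : 0 < a) (hb : 0 < b) (h : 2 * l = a + b) (k : ℕ) :
    poch l k ^ 2 / (poch a k * poch b k) ≤ Real.Gamma a * Real.Gamma b / Real.Gamma l ^ 2 :=
  (poch_ratio_mono l a b hl ha hb h).ge_of_tendsto (poch_ratio_tendsto l a b hl ha hb h) k

lemma real_series (n : ℕ) (x : ℝ) (h0 : 0 ≤ x) (h1 : x < 1) :
    HasSum (fun k => bc n k * x ^ k) (1 / (1 - x) ^ n) := by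
  have h := series (n : ℝ) (x : ℂ) (by simpa [abs_of_nonneg h0] using h1)
  rw [← Complex.hasSum_ofReal]
  simpa using h

open Filter Topology in
lemma abel_lower (n : ℕ) (hn : 0 < n) (q : ℕ → ℝ) (hq : ∀ k, 0 ≤ q k) (L B : ℝ)
    (hL : Tendsto q atTop (𝓝 L)) (S : ℝ → ℝ)
    (hS : ∀ x, 0 ≤ x → x < 1 → HasSum (fun k => bc n k * q k * x ^ k) (S x))
    (hB : ∀ x, 0 ≤ x → x < 1 → (1 - x) ^ n * S x ≤ B) : L ≤ B := by
  refine le_of_forall_lt fun c hc => ?_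
  obtain ⟨c', hc1, hc2⟩ := exists_between hc
  refine lt_of_lt_of_le hc1 ?_
  obtain ⟨K, hK⟩ := eventually_atTop.1 (hL.eventually (lt_mem_nhds hc2))
  have hb : ∀ k, 0 ≤ bc (n : ℝ) k := fun k => bc_nonneg (by exact_mod_cast hn) k
  set A : ℝ := ∑ k ∈ Finset.range K, |c'| * bc n k with hA
  have hlow : ∀ x, 0 ≤ x → x < 1 → c' - A * (1 - x) ^ n ≤ B := by
    intro x h0 h1
    refine le_trans ?_ (hB x h0 h1)
    have s1 := (real_series n x h0 h1).mul_left c'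
    have s2 : HasSum (fun k => if k ∈ Finset.range K then |c'| * bc n k else 0) A := by
      have := hasSum_sum_of_ne_finset_zero (L := SummationFilter.unconditional ℕ)
        (f := fun k => if k ∈ Finset.range K then |c'| * bc n k else 0) (s := Finset.range K)
        (fun b hb => by rw [if_neg hb])
      convert! this using 1
      exact Finset.sum_congr rfl fun k hk => by rw [if_pos hk]
    have hle := hasSum_le (fun k => ?_) (s1.sub s2) (hS x h0 h1)
    · have hp : (0 : ℝ) < (1 - x) ^ n := by have : 0 < 1 - x := by linarith
                                            positivity
      calc c' - A * (1 - x) ^ n = (1 - x) ^ n * (c' * (1 / (1 - x) ^ n) - A) := by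
            field_simp
        _ ≤ _ := by gcongr
    · have hbk := hb k
      have hx : 0 ≤ x ^ k := by positivity
      have hx1 : x ^ k ≤ 1 := pow_le_one₀ h0 h1.le
      have hqk := hq k
      by_cases hk : k ∈ Finset.range K
      · rw [if_pos hk]
        have e1 : c' * (bc n k * x ^ k) ≤ |c'| * bc n k := by
          calc c' * (bc n k * x ^ k) ≤ |c'| * (bc n k * x ^ k) := by gcongr; exact le_abs_self _
            _ ≤ |c'| * bc n k := by gcongr; exact mul_le_of_le_one_right hbk hx1
        have e2 : 0 ≤ bc n k * q k * x ^ k := by positivity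
        linarith
      · rw [if_neg hk, sub_zero]
        have hck : c' ≤ q k := (hK k (by simpa using hk)).le
        calc c' * (bc n k * x ^ k) ≤ q k * (bc n k * x ^ k) := by gcongr
          _ = _ := by ring
  have hlim : Tendsto (fun x : ℝ => c' - A * (1 - x) ^ n) (𝓝[<] 1) (𝓝 c') := by
    have : Tendsto (fun x : ℝ => c' - A * (1 - x) ^ n) (𝓝 1) (𝓝 (c' - A * (1 - 1) ^ n)) :=
      Continuous.tendsto (by fun_prop) 1
    rw [sub_self, zero_pow hn.ne', mul_zero, sub_zero] at this
    exact this.mono_left nhdsWithin_le_nhds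
  refine le_of_tendsto hlim ?_
  filter_upwards [Ioo_mem_nhdsLT (zero_lt_one' ℝ)] with x hx
  exact hlow x hx.1.le hx.2

/-- moments -/
def mom (σ : ℝ) (k : ℕ) : ℝ := (k.factorial : ℝ) / poch (σ + 1) (k + 1)

lemma mom_pos (σ : ℝ) (hσ : -1 < σ) (k : ℕ) : 0 < mom σ k := by
  have := poch_pos (s := σ + 1) (by linarith) (k + 1)
  unfold mom; positivity

open Filter Topology in
lemma mom_ratio (σ : ℝ) (hσ : -1 < σ) (n : ℕ) :
    Tendsto (fun k => mom σ (k + n) / mom σ k) atTop (𝓝 1) := by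
  induction n with
  | zero =>
    refine tendsto_const_nhds.congr fun k => ?_
    rw [add_zero, div_self (mom_pos σ hσ k).ne']
  | succ n ih =>
    have h2 : Tendsto (fun k : ℕ => mom σ (k + (n + 1)) / mom σ (k + n)) atTop (𝓝 1) := by
      have e : ∀ k : ℕ, 1 - (σ + 1) / ((σ + 2 + n) + (k : ℝ)) =
          mom σ (k + (n + 1)) / mom σ (k + n) := by
        intro k
        have p := poch_pos (s := σ + 1) (by linarith) (k + n + 1)
        have hs : (0 : ℝ) < σ + 2 + n + k := by
          have : (0 : ℝ) ≤ n := by positivity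
          have : (0 : ℝ) ≤ k := by positivity
          linarith
        have hs' : (0 : ℝ) < σ + 1 + ((k + n + 1 : ℕ) : ℝ) := by push_cast; linarith
        have pf : (0 : ℝ) < (k + n).factorial := by positivity
        rw [← add_assoc]
        unfold mom
        rw [poch_succ _ (k + n + 1), Nat.factorial_succ]
        rw [Nat.cast_mul]
        field_simp
        push_cast
        ring
      have h0 : Tendsto (fun k : ℕ => (σ + 1) / ((σ + 2 + n) + (k : ℝ))) atTop (𝓝 0) :=
        Tendsto.const_div_atTop
          (tendsto_atTop_add_const_left _ _ tendsto_natCast_atTop_atTop) _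
      have := h0.const_sub 1
      rw [sub_zero] at this
      exact this.congr e
    have := h2.mul ih
    rw [one_mul] at this
    refine this.congr fun k => ?_
    have := mom_pos σ hσ (k + n)
    field_simp

lemma kernel_int (t : ℝ) (ht : 0 < t) (f : ℂ → ℝ) (hf : Integrable f muD) (z : ℂ)
    (hz : ‖z‖ < 1) :
    Integrable (fun w => f w * (1 / ‖1 - z * (starRingEnd ℂ) w‖ ^ t)) muD := by
  refine Integrable.mono' (hf.norm.mul_const (1 / (1 - ‖z‖) ^ t)) ?_ ?_
  · refine hf.1.mul ?_
    exact Measurable.aestronglyMeasurable (by fun_prop)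
  · filter_upwards [ae_disc] with w hw
    have h1 := norm_sub_norm_le (1 : ℂ) (z * (starRingEnd ℂ) w)
    rw [norm_one, norm_mul, RCLike.norm_conj] at h1
    have h2 : 1 - ‖z‖ ≤ ‖1 - z * (starRingEnd ℂ) w‖ := by
      nlinarith [norm_nonneg z, norm_nonneg w]
    have h3 : 0 < 1 - ‖z‖ := by linarith
    rw [norm_mul]
    gcongr
    rw [Real.norm_eq_abs, abs_of_nonneg (by positivity)]
    gcongr

lemma weight_int (σ : ℝ) (hσ : -1 < σ) :
    Integrable (fun w : ℂ => (1 - ‖w‖ ^ 2) ^ σ) muD := by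
  simpa using integrable_weight σ hσ 0

lemma bergman_deriv (σ : ℝ) (hσ : -1 < σ) (n : ℕ) (G : ℂ → ℂ) (hG : Measurable G)
    (hG1 : ∀ w, ‖G w‖ ≤ 1) (z : ℂ) (hz : ‖z‖ < 1) :
    iteratedDeriv n (bergmanD σ G) z =
      ((Real.Gamma (2 + σ + n) / Real.Gamma (σ + 1) : ℝ) : ℂ) *
        ∫ w, (((1 - ‖w‖ ^ 2) ^ σ : ℝ) : ℂ) * G w * (starRingEnd ℂ) w ^ n *
        (1 / (1 - z * (starRingEnd ℂ) w) ^ ((2 + σ + n : ℝ) : ℂ)) ∂muD := by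
  have hint : Integrable (fun w : ℂ => (((1 - ‖w‖ ^ 2) ^ σ : ℝ) : ℂ) * G w) muD := by
    refine Integrable.mono' (weight_int σ hσ).norm ?_ ?_
    · exact (Complex.continuous_ofReal.comp_aestronglyMeasurable (weight_int σ hσ).1).mul
        hG.aestronglyMeasurable
    · filter_upwards with w
      rw [norm_mul, norm_real]
      exact mul_le_of_le_one_right (norm_nonneg _) (hG1 w)
  have e : bergmanD σ G = fun z => ((Real.Gamma (2 + σ) / Real.Gamma (σ + 1) : ℝ) : ℂ) *
      ∫ w, (((1 - ‖w‖ ^ 2) ^ σ : ℝ) : ℂ) * G w *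
        (1 / (1 - z * (starRingEnd ℂ) w) ^ ((2 + σ : ℝ) : ℂ)) ∂muD := by
    ext z
    unfold bergmanD muD
    congr 1
    refine integral_congr_ae (Filter.Eventually.of_forall fun w => ?_)
    simp only
    ring
  have hgam : ∀ n : ℕ, Real.Gamma (2 + σ + n) = poch (2 + σ) n * Real.Gamma (2 + σ) := by
    intro n
    induction n with
    | zero => simp [poch]
    | succ n ih =>
      have h0 : (0 : ℝ) < 2 + σ + n := by
        have : (0 : ℝ) ≤ n := by positivity
        linarith
      have : 2 + σ + ((n + 1 : ℕ) : ℝ) = 2 + σ + n + 1 := by push_cast; ring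
      rw [this, Real.Gamma_add_one h0.ne', ih, poch_succ]
      ring
  rw [e, iteratedDeriv_const_mul_field, iter_deriv _ hint (2 + σ) (by linarith) n z hz, hgam n]
  push_cast
  ring

lemma upper_int (σ : ℝ) (hσ : -1 < σ) (n : ℕ) (hn : 0 < n) (z : ℂ) (hz : ‖z‖ < 1) :
    (1 - ‖z‖ ^ 2) ^ n * ∫ w : ℂ, (1 - ‖w‖ ^ 2) ^ σ *
        (1 / ‖1 - z * (starRingEnd ℂ) w‖ ^ (2 + σ + n)) ∂muD ≤
      Real.Gamma (σ + 1) * Real.Gamma n / Real.Gamma (1 + (σ + n) / 2) ^ 2 := by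
  set l : ℝ := 1 + (σ + n) / 2 with hl
  have hn1 : (1 : ℝ) ≤ n := by exact_mod_cast hn
  have hn0 : (0 : ℝ) < n := by linarith
  have hl0 : 0 < l := by rw [hl]; linarith
  have h2l : 2 + σ + n = 2 * l := by rw [hl]; ring
  have P := parseval l hl0 (fun r => (1 - r ^ 2) ^ σ) (weight_int σ hσ) z hz
  rw [h2l]
  have hx1 : ‖z‖ ^ 2 < 1 := by nlinarith [norm_nonneg z]
  set L := Real.Gamma (σ + 1) * Real.Gamma n / Real.Gamma l ^ 2 with hL
  have R := (real_series n (‖z‖ ^ 2) (by positivity) hx1).mul_left L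
  have hle := hasSum_le (fun k => ?_) P R
  · have hp : 0 < (1 - ‖z‖ ^ 2) ^ n := by
      have : 0 < 1 - ‖z‖ ^ 2 := by linarith
      positivity
    calc _ ≤ (1 - ‖z‖ ^ 2) ^ n * (L * (1 / (1 - ‖z‖ ^ 2) ^ n)) := by gcongr
      _ = L := by field_simp
  · have hm := moment σ hσ k
    rw [hm]
    have h1 := poch_ratio_le l n (σ + 2) hl0 hn0 (by linarith) (by rw [hl]; ring) k
    have hps : poch (σ + 1) (k + 1) = (σ + 1) * poch (σ + 2) k := by
      unfold poch
      rw [Finset.prod_range_succ', mul_comm]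
      simp only [Nat.cast_zero, add_zero]
      congr 1
      refine Finset.prod_congr rfl fun j _ => ?_
      push_cast; ring
    have hG : Real.Gamma (σ + 2) = (σ + 1) * Real.Gamma (σ + 1) := by
      rw [← Real.Gamma_add_one (by linarith)]; congr 1; ring
    have hσ1 : 0 < σ + 1 := by linarith
    have p1 := poch_pos hl0 k
    have p2 := poch_pos hn0 k
    have p3 := poch_pos (s := σ + 2) (by linarith) k
    have pf : (0 : ℝ) < k.factorial := by positivity
    have hL2 : Real.Gamma n * Real.Gamma (σ + 2) / Real.Gamma l ^ 2 = (σ + 1) * L := by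
      rw [hL, hG]; ring
    rw [hL2] at h1
    have h4 : 0 ≤ bc n k * (‖z‖ ^ 2) ^ k / (σ + 1) := by
      have := bc_nonneg hn0 k
      positivity
    have h3 := mul_le_mul_of_nonneg_right h1 h4
    calc _ = poch l k ^ 2 / (poch n k * poch (σ + 2) k) *
          (bc n k * (‖z‖ ^ 2) ^ k / (σ + 1)) := by
          rw [hps]; unfold bc; field_simp
      _ ≤ _ := h3
      _ = _ := by field_simp

lemma lower_series (σ : ℝ) (hσ : -1 < σ) (n : ℕ) (hn : 0 < n) (B : ℝ)
    (hB : ∀ z : ℂ, ‖z‖ < 1 → (1 - ‖z‖ ^ 2) ^ n * ∫ w : ℂ, ((1 - ‖w‖ ^ 2) ^ σ * (‖w‖ ^ 2) ^ n) *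
        (1 / ‖1 - z * (starRingEnd ℂ) w‖ ^ (2 + σ + n)) ∂muD ≤ B) :
    Real.Gamma (σ + 1) * Real.Gamma n / Real.Gamma (1 + (σ + n) / 2) ^ 2 ≤ B := by
  set l : ℝ := 1 + (σ + n) / 2 with hl
  have hn1 : (1 : ℝ) ≤ n := by exact_mod_cast hn
  have hn0 : (0 : ℝ) < n := by linarith
  have hl0 : 0 < l := by rw [hl]; linarith
  have h2l : 2 + σ + n = 2 * l := by rw [hl]; ring
  have hσ1 : 0 < σ + 1 := by linarith
  have hlim := ((poch_ratio_tendsto l n (σ + 2) hl0 hn0 (by linarith) (by rw [hl]; ring)).mul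
    (mom_ratio σ hσ n)).div_const (σ + 1)
  have hps : ∀ k, poch (σ + 1) (k + 1) = (σ + 1) * poch (σ + 2) k := by
    intro k
    unfold poch
    rw [Finset.prod_range_succ', mul_comm]
    simp only [Nat.cast_zero, add_zero]
    congr 1
    refine Finset.prod_congr rfl fun j _ => ?_
    push_cast; ring
  have hG : Real.Gamma (σ + 2) = (σ + 1) * Real.Gamma (σ + 1) := by
    rw [← Real.Gamma_add_one (by linarith)]; congr 1; ring
  have hL2 : Real.Gamma n * Real.Gamma (σ + 2) / Real.Gamma l ^ 2 * 1 / (σ + 1) =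
      Real.Gamma (σ + 1) * Real.Gamma n / Real.Gamma l ^ 2 := by
    rw [hG]; field_simp
  rw [hL2] at hlim
  refine abel_lower n hn _ (fun k => ?_) _ B hlim (fun x => ∫ w : ℂ,
    ((1 - ‖w‖ ^ 2) ^ σ * (‖w‖ ^ 2) ^ n) *
      (1 / ‖1 - ((Real.sqrt x : ℝ) : ℂ) * (starRingEnd ℂ) w‖ ^ (2 * l)) ∂muD) ?_ ?_
  · have p1 := poch_pos hl0 k
    have p2 := poch_pos hn0 k
    have p3 := poch_pos (s := σ + 2) (by linarith) k
    have := mom_pos σ hσ k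
    have := mom_pos σ hσ (k + n)
    positivity
  · intro x h0 h1
    have hns : ‖((Real.sqrt x : ℝ) : ℂ)‖ = Real.sqrt x := by
      rw [norm_real, Real.norm_eq_abs, abs_of_nonneg (Real.sqrt_nonneg _)]
    have P := parseval l hl0 (fun r => (1 - r ^ 2) ^ σ * (r ^ 2) ^ n) (integrable_weight σ hσ n)
      ((Real.sqrt x : ℝ) : ℂ) (by rw [hns, Real.sqrt_lt' one_pos]; linarith)
    rw [hns, Real.sq_sqrt h0] at P
    convert! P using 2 with k
    have hm : ∫ w : ℂ, (1 - ‖w‖ ^ 2) ^ σ * (‖w‖ ^ 2) ^ n * (‖w‖ ^ 2) ^ k ∂muD = mom σ (k + n) := by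
      rw [mom, ← moment σ hσ (k + n)]
      congr 1
      ext w
      rw [pow_add]; ring
    rw [hm]
    have p1 := poch_pos hl0 k
    have p2 := poch_pos hn0 k
    have p3 := poch_pos (s := σ + 2) (by linarith) k
    have pf : (0 : ℝ) < k.factorial := by positivity
    have hmk : mom σ k = k.factorial / ((σ + 1) * poch (σ + 2) k) := by rw [mom, hps]
    rw [hmk]
    unfold bc
    field_simp
  · intro x h0 h1
    have hns : ‖((Real.sqrt x : ℝ) : ℂ)‖ = Real.sqrt x := by
      rw [norm_real, Real.norm_eq_abs, abs_of_nonneg (Real.sqrt_nonneg _)]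
    have := hB ((Real.sqrt x : ℝ) : ℂ) (by rw [hns, Real.sqrt_lt' one_pos]; linarith)
    rwa [hns, Real.sq_sqrt h0, h2l] at this

/-- extremal function -/
def extG (s : ℝ) (n : ℕ) (z w : ℂ) : ℂ :=
  (starRingEnd ℂ) ((starRingEnd ℂ) w ^ n * (1 / (1 - z * (starRingEnd ℂ) w) ^ (s : ℂ))) /
    (‖(starRingEnd ℂ) w ^ n * (1 / (1 - z * (starRingEnd ℂ) w) ^ (s : ℂ))‖ : ℂ)

lemma extG_meas (s : ℝ) (n : ℕ) (z : ℂ) : Measurable (extG s n z) := by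
  have h : Measurable fun w : ℂ =>
      (starRingEnd ℂ) w ^ n * (1 / (1 - z * (starRingEnd ℂ) w) ^ (s : ℂ)) := by fun_prop
  exact (Complex.continuous_conj.measurable.comp h).div
    (Complex.measurable_ofReal.comp h.norm)

lemma extG_le (s : ℝ) (n : ℕ) (z w : ℂ) : ‖extG s n z w‖ ≤ 1 := by
  unfold extG
  rw [norm_div, RCLike.norm_conj, norm_real, norm_norm]
  exact div_self_le_one _

lemma extG_mul (s : ℝ) (n : ℕ) (z w : ℂ) :
    extG s n z w * ((starRingEnd ℂ) w ^ n * (1 / (1 - z * (starRingEnd ℂ) w) ^ (s : ℂ))) =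
      ((‖w‖ ^ n * (1 / ‖1 - z * (starRingEnd ℂ) w‖ ^ s) : ℝ) : ℂ) := by
  have h1 : ‖(starRingEnd ℂ) w ^ n * (1 / (1 - z * (starRingEnd ℂ) w) ^ (s : ℂ))‖ =
      ‖w‖ ^ n * (1 / ‖1 - z * (starRingEnd ℂ) w‖ ^ s) := by
    rw [norm_mul, norm_pow, RCLike.norm_conj, norm_kernel]
  rw [← h1]
  unfold extG
  generalize (starRingEnd ℂ) w ^ n * (1 / (1 - z * (starRingEnd ℂ) w) ^ (s : ℂ)) = u
  by_cases hu : u = 0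
  · simp [hu]
  · have : (‖u‖ : ℂ) ≠ 0 := by simpa using hu
    rw [div_mul_eq_mul_div, mul_comm, Complex.mul_conj', div_eq_iff this]
    ring

lemma upper_bound (n : ℕ) (hn : 0 < n) (σ : ℝ) (hσ : -1 < σ) (G : ℂ → ℂ) (hG : Measurable G)
    (hG1 : ∀ w, ‖G w‖ ≤ 1) (z : ℂ) (hz : ‖z‖ < 1) :
    (1 - ‖z‖ ^ 2) ^ n * ‖iteratedDeriv n (bergmanD σ G) z‖ ≤
      Real.Gamma (2 + σ + n) * Real.Gamma n / Real.Gamma (1 + (σ + n) / 2) ^ 2 := by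
  have hn0 : (0 : ℝ) < n := by exact_mod_cast hn
  have g1 : 0 < Real.Gamma (σ + 1) := Real.Gamma_pos_of_pos (by linarith)
  have g2 : 0 < Real.Gamma (2 + σ + n) := Real.Gamma_pos_of_pos (by linarith)
  rw [bergman_deriv σ hσ n G hG hG1 z hz, norm_mul, norm_real, Real.norm_eq_abs,
    abs_of_pos (by positivity)]
  have hI := norm_integral_le_of_norm_le
    (kernel_int (2 + σ + n) (by linarith) _ (weight_int σ hσ) z hz)
    (f := fun w => (((1 - ‖w‖ ^ 2) ^ σ : ℝ) : ℂ) * G w * (starRingEnd ℂ) w ^ n *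
        (1 / (1 - z * (starRingEnd ℂ) w) ^ ((2 + σ + n : ℝ) : ℂ))) (by
      filter_upwards [ae_disc] with w hw
      have h0 : 0 ≤ (1 - ‖w‖ ^ 2) ^ σ :=
        Real.rpow_nonneg (by nlinarith [norm_nonneg w]) _
      rw [norm_mul, norm_mul, norm_mul, norm_kernel, norm_real, Real.norm_eq_abs,
        abs_of_nonneg h0]
      gcongr
      rw [norm_pow, RCLike.norm_conj, mul_assoc]
      refine mul_le_of_le_one_right h0 ?_
      exact mul_le_one₀ (hG1 w) (by positivity) (pow_le_one₀ (norm_nonneg _) hw.le))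
  have hU := upper_int σ hσ n hn z hz
  have hp : 0 ≤ (1 - ‖z‖ ^ 2) ^ n := by
    have : 0 ≤ 1 - ‖z‖ ^ 2 := by nlinarith [norm_nonneg z]
    positivity
  have h2 := (mul_le_mul_of_nonneg_left hI hp).trans hU
  have h3 := mul_le_mul_of_nonneg_left h2
    (div_pos g2 g1).le
  refine le_trans (le_of_eq ?_) (h3.trans (le_of_eq ?_))
  · ring
  · field_simp

lemma lower_bound (n : ℕ) (hn : 0 < n) (σ : ℝ) (hσ : -1 < σ) (B : ℝ)
    (hB : ∀ G : ℂ → ℂ, Measurable G → (∀ w, ‖G w‖ ≤ 1) → ∀ z : ℂ, ‖z‖ < 1 →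
      (1 - ‖z‖ ^ 2) ^ n * ‖iteratedDeriv n (bergmanD σ G) z‖ ≤ B) :
    Real.Gamma (2 + σ + n) * Real.Gamma n / Real.Gamma (1 + (σ + n) / 2) ^ 2 ≤ B := by
  have hn0 : (0 : ℝ) < n := by exact_mod_cast hn
  have g1 : 0 < Real.Gamma (σ + 1) := Real.Gamma_pos_of_pos (by linarith)
  have g2 : 0 < Real.Gamma (2 + σ + n) := Real.Gamma_pos_of_pos (by linarith)
  have key := lower_series σ hσ n hn (B / (Real.Gamma (2 + σ + n) / Real.Gamma (σ + 1))) ?_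
  · rw [le_div_iff₀ (by positivity)] at key
    refine le_trans (le_of_eq ?_) key
    field_simp
  intro z hz
  rw [le_div_iff₀ (by positivity)]
  refine le_trans ?_ (hB (extG (2 + σ + n) n z) (extG_meas _ _ _) (extG_le _ _ _) z hz)
  have hp : 0 ≤ (1 - ‖z‖ ^ 2) ^ n := by
    have : 0 ≤ 1 - ‖z‖ ^ 2 := by nlinarith [norm_nonneg z]
    positivity
  rw [bergman_deriv σ hσ n _ (extG_meas _ _ _) (extG_le _ _ _) z hz, norm_mul, norm_real,
    Real.norm_eq_abs, abs_of_pos (by positivity), mul_assoc, mul_comm (∫ _, _ ∂muD)]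
  gcongr
  have e : ∀ w : ℂ, (((1 - ‖w‖ ^ 2) ^ σ : ℝ) : ℂ) * extG (2 + σ + n) n z w *
      (starRingEnd ℂ) w ^ n * (1 / (1 - z * (starRingEnd ℂ) w) ^ ((2 + σ + n : ℝ) : ℂ)) =
      (((1 - ‖w‖ ^ 2) ^ σ * ‖w‖ ^ n * (1 / ‖1 - z * (starRingEnd ℂ) w‖ ^ (2 + σ + n)) : ℝ) : ℂ) := by
    intro w
    rw [mul_assoc, mul_assoc, extG_mul, ← ofReal_mul]
    congr 1
    ring
  simp only [e]
  rw [integral_complex_ofReal, norm_real, Real.norm_eq_abs]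
  refine le_trans ?_ (le_abs_self _)
  have hwn : Integrable (fun w : ℂ => (1 - ‖w‖ ^ 2) ^ σ * ‖w‖ ^ n) muD := by
    refine Integrable.mono' (weight_int σ hσ).norm ?_ ?_
    · exact (weight_int σ hσ).1.mul (Continuous.aestronglyMeasurable (by fun_prop))
    · filter_upwards [ae_disc] with w hw
      rw [norm_mul, norm_pow, norm_norm]
      exact mul_le_of_le_one_right (norm_nonneg _) (pow_le_one₀ (norm_nonneg _) hw.le)
  refine integral_mono_ae (kernel_int _ (by linarith) _ (integrable_weight σ hσ n) z hz)
    (kernel_int _ (by linarith) _ hwn z hz) ?_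
  filter_upwards [ae_disc] with w hw
  have h0 : 0 ≤ (1 - ‖w‖ ^ 2) ^ σ :=
    Real.rpow_nonneg (by nlinarith [norm_nonneg w]) _
  have : (‖w‖ ^ 2) ^ n ≤ ‖w‖ ^ n :=
    pow_le_pow_left₀ (by positivity) (by nlinarith [norm_nonneg w]) n
  gcongr

/-- The one-dimensional case: for any conjugation-invariant norm `|·|_ℂ` on `ℂ` and the Bloch
seminorm `‖f‖_𝓑 = sup_{z∈U} (1-|z|²)^n |f^{(n)}(z)|_ℂ`, the Bergman projection satisfies
`‖T_σ‖_{L^∞(U)→𝓑} = 𝓒 · Γ(2+σ+n)Γ(n)/Γ(1+(σ+n)/2)²` with `𝓒 = max_{|ζ|=1} |ζ|_ℂ`. -/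
theorem bergman_projection_seminorm_disc
    (n : ℕ) (hn : 0 < n) (σ : ℝ) (hσ : -1 < σ)
    (N : ℂ → ℝ)
    (hN_nonneg : ∀ x, 0 ≤ N x)
    (hN_def : ∀ x, N x = 0 → x = 0)
    (hN_add : ∀ x y, N (x + y) ≤ N x + N y)
    (hN_smul : ∀ (c : ℂ) (x), N (c • x) = ‖c‖ * N x)
    (hN_conj : ∀ x, N ((starRingEnd ℂ) x) = N x) :
    (⨆ G : {G : ℂ → ℂ // Measurable G ∧ ∀ w, ‖G w‖ ≤ 1},
        ⨆ z : unitDisc, (1 - ‖(z : ℂ)‖ ^ 2) ^ n * N (iteratedDeriv n (bergmanD σ G.1) (z : ℂ))) =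
      (⨆ ζ : Metric.sphere (0 : ℂ) 1, N (ζ : ℂ)) *
        (Real.Gamma (2 + σ + n) * Real.Gamma n / Real.Gamma (1 + (σ + n) / 2) ^ 2) := by
  have hNz : ∀ x, N x = ‖x‖ * N 1 := fun x => by
    have := hN_smul x 1
    simpa using this
  have hC : (⨆ ζ : Metric.sphere (0 : ℂ) 1, N (ζ : ℂ)) = N 1 := by
    haveI : Nonempty (Metric.sphere (0 : ℂ) 1) := ⟨⟨1, by simp⟩⟩
    have : ∀ ζ : Metric.sphere (0 : ℂ) 1, N (ζ : ℂ) = N 1 := fun ζ => by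
      rw [hNz, norm_eq_of_mem_sphere ζ, one_mul]
    simp only [this, ciSup_const]
  have hN1 : 0 < N 1 := lt_of_le_of_ne (hN_nonneg 1) fun h => one_ne_zero (hN_def 1 h.symm)
  rw [hC]
  set R := Real.Gamma (2 + σ + n) * Real.Gamma n / Real.Gamma (1 + (σ + n) / 2) ^ 2 with hR
  have hup : ∀ (G : {G : ℂ → ℂ // Measurable G ∧ ∀ w, ‖G w‖ ≤ 1}) (z : unitDisc),
      (1 - ‖(z : ℂ)‖ ^ 2) ^ n * N (iteratedDeriv n (bergmanD σ G.1) (z : ℂ)) ≤ N 1 * R := by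
    intro G z
    have hz : ‖(z : ℂ)‖ < 1 := by simpa [unitDisc] using z.2
    have h := upper_bound n hn σ hσ G.1 G.2.1 G.2.2 z hz
    rw [hNz, ← mul_assoc, mul_comm]
    exact mul_le_mul_of_nonneg_left h hN1.le
  haveI : Nonempty unitDisc := ⟨⟨0, by simp [unitDisc]⟩⟩
  haveI : Nonempty {G : ℂ → ℂ // Measurable G ∧ ∀ w, ‖G w‖ ≤ 1} :=
    ⟨⟨fun _ => 0, measurable_const, fun _ => by simp⟩⟩
  have hin : ∀ G : {G : ℂ → ℂ // Measurable G ∧ ∀ w, ‖G w‖ ≤ 1},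
      (⨆ z : unitDisc, (1 - ‖(z : ℂ)‖ ^ 2) ^ n * N (iteratedDeriv n (bergmanD σ G.1) (z : ℂ))) ≤
        N 1 * R := fun G => ciSup_le (hup G)
  refine le_antisymm (ciSup_le hin) ?_
  rw [← le_div_iff₀' hN1]
  refine lower_bound n hn σ hσ _ fun G hG hG1 z hz => ?_
  rw [le_div_iff₀' hN1]
  have h1 : (1 - ‖z‖ ^ 2) ^ n * N (iteratedDeriv n (bergmanD σ G) z) ≤
      ⨆ z : unitDisc, (1 - ‖(z : ℂ)‖ ^ 2) ^ n * N (iteratedDeriv n (bergmanD σ G) (z : ℂ)) :=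
    le_ciSup (f := fun z : unitDisc =>
      (1 - ‖(z : ℂ)‖ ^ 2) ^ n * N (iteratedDeriv n (bergmanD σ G) (z : ℂ)))
      ⟨N 1 * R, by rintro _ ⟨z, rfl⟩; exact hup ⟨G, hG, hG1⟩ z⟩
      ⟨z, by simpa [unitDisc] using hz⟩
  have h2 := le_ciSup (f := fun G : {G : ℂ → ℂ // Measurable G ∧ ∀ w, ‖G w‖ ≤ 1} =>
      ⨆ z : unitDisc, (1 - ‖(z : ℂ)‖ ^ 2) ^ n * N (iteratedDeriv n (bergmanD σ G.1) (z : ℂ)))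
      ⟨N 1 * R, by rintro _ ⟨G, rfl⟩; exact hin G⟩ ⟨G, hG, hG1⟩
  refine le_trans (le_of_eq ?_) (h1.trans h2)
  rw [hNz (iteratedDeriv n (bergmanD σ G) z)]
  ring

end
end
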